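/- Let N ≥ 2, let f ∈ L^1(S^N) and let α > (N-1)/2. Then there exists a constant c, not depending on f, such that for every μ > 0 one has σ{ x ∈ S^N : S_*^α f(x) > μ } ≤ c ‖f‖_{L^1(S^N)} / μ; that is, the Cesàro maximal operator S_*^α is of weak type (1,1) on the sphere. -/

import Mathlib

open MeasureTheory Metric Real Filter
open scoped BigOperators ENNReal NNReal RealInnerProductSpace Topology

noncomputable section

/-- The unit sphere `S^N` as a subtype of `ℝ^{N+1}` (with the Euclidean structure). -/
abbrev Sph (N : ℕ) : Type := Metric.sphere (0 : EuclideanSpace ℝ (Fin (N + 1))) 1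

/-- The surface measure `σ` on the sphere `S^N`. -/
def sphMeasure (N : ℕ) : Measure (Sph N) :=
  (volume : Measure (EuclideanSpace ℝ (Fin (N + 1)))).toSphere

/-- The spherical (geodesic) distance `γ(x,y) ∈ [0,π]` between two points of `S^N`. -/
def geoDist {N : ℕ} (x y : Sph N) : ℝ :=
  Real.arccos ⟪(x : EuclideanSpace ℝ (Fin (N + 1))), (y : EuclideanSpace ℝ (Fin (N + 1)))⟫

/-- The spherical ball `B(x,r) = {y : γ(x,y) ≤ r}`. -/
def sphBall {N : ℕ} (x : Sph N) (r : ℝ) : Set (Sph N) := {y | geoDist x y ≤ r}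

/-- The point of the sphere diametrically opposite to `x`. -/
def antipode {N : ℕ} (x : Sph N) : Sph N :=
  ⟨-(x : EuclideanSpace ℝ (Fin (N + 1))), by
    have hx := x.2
    simp only [mem_sphere_iff_norm, sub_zero, norm_neg] at hx ⊢
    exact hx⟩

/-- A spherical harmonic of degree `k` on `S^N`: the restriction to the sphere of a
homogeneous polynomial of degree `k` on `ℝ^{N+1}` annihilated by the Euclidean Laplacian
(equivalently, an eigenfunction of the Laplace–Beltrami operator `−Δ_s` with
eigenvalue `k(k+N−1)`). -/
def IsSphericalHarmonic (N k : ℕ) (g : Sph N → ℝ) : Prop :=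
  ∃ P : MvPolynomial (Fin (N + 1)) ℝ,
    P.IsHomogeneous k ∧
    (∑ i, MvPolynomial.pderiv i (MvPolynomial.pderiv i P)) = 0 ∧
    ∀ x : Sph N, g x = MvPolynomial.eval (fun i => (x : EuclideanSpace ℝ (Fin (N + 1))) i) P

/-- `Y k j`, `j < a k`, is for each `k` an orthonormal basis (w.r.t. `L²(S^N, σ)`)
of the space `ℵ_k` of spherical harmonics of degree `k`. -/
structure IsFourierLaplaceBasis (N : ℕ) (a : ℕ → ℕ) (Y : (k : ℕ) → Fin (a k) → Sph N → ℝ) :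
    Prop where
  harmonic : ∀ k j, IsSphericalHarmonic N k (Y k j)
  orthonormal : ∀ k, ∀ j j' : Fin (a k),
    ∫ x, Y k j x * Y k j' x ∂(sphMeasure N) = if j = j' then 1 else 0
  spanning : ∀ k (g : Sph N → ℝ), IsSphericalHarmonic N k g →
    g ∈ Submodule.span ℝ (Set.range (Y k))

/-- The Cesàro number `A_m^α = Γ(α+m+1)/(Γ(α+1) m!)`. -/
def cesaroA (α : ℝ) (m : ℕ) : ℝ :=
  Real.Gamma (α + m + 1) / (Real.Gamma (α + 1) * (Nat.factorial m))

/-- The Fourier–Laplace coefficient `f_{k,j} = ∫_{S^N} f(y) Y_j^k(y) dσ(y)`. -/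
def flCoeff {N : ℕ} {a : ℕ → ℕ} (Y : (k : ℕ) → Fin (a k) → Sph N → ℝ) (f : Sph N → ℝ)
    (k : ℕ) (j : Fin (a k)) : ℝ :=
  ∫ y, f y * Y k j y ∂(sphMeasure N)

/-- The Cesàro mean of order `α` of the Fourier–Laplace series of `f`:
`S_n^α f(x) = (1/A_n^α) Σ_{k=0}^n A_{n−k}^α Σ_{j=1}^{a_k} f_{k,j} Y_j^k(x)`. -/
def cesaroMean {N : ℕ} {a : ℕ → ℕ} (Y : (k : ℕ) → Fin (a k) → Sph N → ℝ) (α : ℝ)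
    (f : Sph N → ℝ) (n : ℕ) (x : Sph N) : ℝ :=
  (cesaroA α n)⁻¹ *
    ∑ k ∈ Finset.range (n + 1), cesaroA α (n - k) * ∑ j, flCoeff Y f k j * Y k j x

/-- The maximal operator `S_*^α f(x) = sup_{n ≥ 1} |S_n^α f(x)|` (with values in `ℝ≥0∞`). -/
def cesaroMaximal {N : ℕ} {a : ℕ → ℕ} (Y : (k : ℕ) → Fin (a k) → Sph N → ℝ) (α : ℝ)
    (f : Sph N → ℝ) (x : Sph N) : ℝ≥0∞ :=
  ⨆ (n : ℕ) (_ : 1 ≤ n), ENNReal.ofReal |cesaroMean Y α f n x|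

/-- The Hardy–Littlewood maximal function
`f*(x) = sup_{r>0} (1/σ(B(x,r))) ∫_{B(x,r)} |f| dσ` (with values in `ℝ≥0∞`). -/
def hlMaximal {N : ℕ} (f : Sph N → ℝ) (x : Sph N) : ℝ≥0∞ :=
  ⨆ (r : ℝ) (_ : 0 < r),
    (sphMeasure N (sphBall x r))⁻¹ * ∫⁻ y in sphBall x r, ENNReal.ofReal |f y| ∂(sphMeasure N)

/-- The Cesàro means of order `α` of the spectral function:
`Θ^α(x,y,n) = (1/A_n^α) Σ_{k=0}^n A_{n−k}^α Σ_{j=1}^{a_k} Y_j^k(x) Y_j^k(y)`. -/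
def cesaroKernel {N : ℕ} {a : ℕ → ℕ} (Y : (k : ℕ) → Fin (a k) → Sph N → ℝ) (α : ℝ)
    (n : ℕ) (x y : Sph N) : ℝ :=
  (cesaroA α n)⁻¹ *
    ∑ k ∈ Finset.range (n + 1), cesaroA α (n - k) * ∑ j, Y k j x * Y k j y

/-! ### Binomial and Gegenbauer coefficients -/

/-- The Taylor coefficients of `(1 - z) ^ (-μ)`. -/
def risingCoeff (μ : ℝ) : ℕ → ℝ
  | 0 => 1
  | k + 1 => risingCoeff μ k * (μ + k) / (k + 1)

/-- Homogenized Gegenbauer polynomials: the coefficients of `(1 - 2 s z + ρ z²) ^ (-lam)`. -/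
def gegenbauer {R : Type*} [CommRing R] [Algebra ℝ R] (lam : ℝ) (s ρ : R) : ℕ → R
  | 0 => 1
  | 1 => (2 * lam) • s
  | n + 2 => ((n : ℝ) + 2)⁻¹ • ((2 * (n + 1 + lam)) • (s * gegenbauer lam s ρ (n + 1)) -
      (n + 2 * lam) • (ρ * gegenbauer lam s ρ n))

theorem AlgHom.map_gegenbauer {R S : Type*} [CommRing R] [Algebra ℝ R] [CommRing S] [Algebra ℝ S]
    (φ : R →ₐ[ℝ] S) (lam : ℝ) (s ρ : R) (n : ℕ) :
    φ (gegenbauer lam s ρ n) = gegenbauer lam (φ s) (φ ρ) n := by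
  induction n using Nat.twoStepInduction with
  | zero => simp [gegenbauer]
  | one => simp [gegenbauer]
  | more n h0 h1 => simp [gegenbauer, h0, h1]

theorem risingCoeff_mul_succ (μ : ℝ) (k : ℕ) :
    risingCoeff μ (k + 1) * (k + 1) = risingCoeff μ k * (μ + k) := by
  have : (k : ℝ) + 1 ≠ 0 := by positivity
  rw [risingCoeff]; field_simp

theorem mul_risingCoeff_add_one (μ : ℝ) (k : ℕ) :
    μ * risingCoeff (μ + 1) k = risingCoeff μ k * (μ + k) := by
  induction k with
  | zero => simp [risingCoeff]
  | succ k ih =>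
    have h : (k : ℝ) + 1 ≠ 0 := by positivity
    rw [risingCoeff, risingCoeff, mul_div_assoc', ← mul_assoc, ih]
    push_cast
    field_simp
    ring

theorem risingCoeff_add_one_succ {μ : ℝ} (hμ : 0 < μ) (k : ℕ) :
    risingCoeff (μ + 1) (k + 1) - risingCoeff (μ + 1) k = risingCoeff μ (k + 1) := by
  have h : (k : ℝ) + 1 ≠ 0 := by positivity
  have h2 := mul_risingCoeff_add_one μ k
  have h3 := mul_risingCoeff_add_one μ (k + 1)
  have h4 := risingCoeff_mul_succ μ k
  apply mul_left_cancel₀ hμ.ne'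
  rw [mul_sub, h2, h3]
  push_cast
  linear_combination h4

theorem risingCoeff_pos {μ : ℝ} (hμ : 0 < μ) (k : ℕ) : 0 < risingCoeff μ k := by
  induction k with
  | zero => simp [risingCoeff]
  | succ k ih => rw [risingCoeff]; positivity

theorem cesaroA_eq_risingCoeff {α : ℝ} (hα : 0 < α) (m : ℕ) :
    cesaroA α m = risingCoeff (α + 1) m := by
  induction m with
  | zero =>
    simp only [cesaroA, risingCoeff, Nat.cast_zero, add_zero, Nat.factorial_zero, Nat.cast_one,
      mul_one]
    exact div_self (Real.Gamma_pos_of_pos (by linarith)).ne'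
  | succ k ih =>
    rw [risingCoeff, ← ih, cesaroA, cesaroA]
    have h : α + (k + 1 : ℕ) + 1 = (α + k + 1) + 1 := by push_cast; ring
    rw [h, Real.Gamma_add_one (by positivity), Nat.factorial_succ]
    have h1 := (Real.Gamma_pos_of_pos (show 0 < α + 1 by linarith)).ne'
    have h2 : (k.factorial : ℝ) ≠ 0 := by positivity
    push_cast
    field_simp
    ring

open PowerSeries in
/-- The formal power series of `(1 - a z) ^ (-μ)`. -/
def binomSeries (μ : ℝ) (a : ℂ) : PowerSeries ℂ :=
  PowerSeries.mk fun k => (risingCoeff μ k : ℂ) * a ^ k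

theorem one_sub_mul_binomSeries {μ : ℝ} (hμ : 0 < μ) (a : ℂ) :
    (1 - PowerSeries.C a * PowerSeries.X) * binomSeries (μ + 1) a = binomSeries μ a := by
  ext k
  cases k with
  | zero => simp [sub_mul, mul_assoc, binomSeries, risingCoeff]
  | succ k =>
    have := risingCoeff_add_one_succ hμ k
    simp only [sub_mul, one_mul, mul_assoc, binomSeries, map_sub, PowerSeries.coeff_mk,
      PowerSeries.coeff_C_mul, PowerSeries.coeff_succ_X_mul, ← this]
    push_cast
    ring

theorem derivative_binomSeries (μ : ℝ) (a : ℂ) :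
    PowerSeries.derivative ℂ (binomSeries μ a) =
      PowerSeries.C ((μ : ℂ) * a) * binomSeries (μ + 1) a := by
  ext k
  have h1 := risingCoeff_mul_succ μ k
  have h2 := mul_risingCoeff_add_one μ k
  have h : (risingCoeff μ (k + 1) : ℂ) * (k + 1) = μ * risingCoeff (μ + 1) k := by
    exact_mod_cast h1.trans h2.symm
  simp only [PowerSeries.coeff_derivative, binomSeries, PowerSeries.coeff_mk,
    PowerSeries.coeff_C_mul]
  linear_combination a ^ (k + 1) * h

/-- The formal identity `(1 - 2 t z + z²) ^ (-lam) = Σ C_k z ^ k`. -/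
theorem coeff_binomSeries_mul {lam : ℝ} (hl : 0 < lam) {a b : ℂ} {t : ℝ} (hab : a * b = 1)
    (hs : a + b = 2 * t) (k : ℕ) :
    PowerSeries.coeff k (binomSeries lam a * binomSeries lam b) = gegenbauer lam (t : ℂ) 1 k := by
  set F := binomSeries lam a * binomSeries lam b with hF
  have key : (1 - PowerSeries.C (2 * t : ℂ) * PowerSeries.X + PowerSeries.X ^ 2) *
      PowerSeries.derivative ℂ F = (PowerSeries.C (2 * lam * t : ℂ)
        - PowerSeries.C (2 * lam : ℂ) * PowerSeries.X) * F := by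
    have hD : (1 - PowerSeries.C (2 * t : ℂ) * PowerSeries.X + PowerSeries.X ^ 2 :
        PowerSeries ℂ) = (1 - PowerSeries.C a * PowerSeries.X) *
          (1 - PowerSeries.C b * PowerSeries.X) := by
      have : (PowerSeries.C a * PowerSeries.C b : PowerSeries ℂ) = 1 := by
        rw [← map_mul, hab, map_one]
      rw [← hs, map_add]
      linear_combination (-PowerSeries.X ^ 2) * this
    have h1 := one_sub_mul_binomSeries hl a
    have h2 := one_sub_mul_binomSeries hl b
    have hab' : (PowerSeries.C a * PowerSeries.C b : PowerSeries ℂ) = 1 := by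
      rw [← map_mul, hab, map_one]
    have hs' : (PowerSeries.C a + PowerSeries.C b : PowerSeries ℂ) = 2 * PowerSeries.C (t : ℂ) := by
      rw [← map_add, hs, map_mul, map_ofNat]
    rw [hD, hF, Derivation.leibniz, derivative_binomSeries, derivative_binomSeries, smul_eq_mul,
      smul_eq_mul, ← h1, ← h2]
    simp only [map_mul, map_ofNat]
    linear_combination (PowerSeries.C (lam : ℂ) * (1 - PowerSeries.C a * PowerSeries.X) *
      (1 - PowerSeries.C b * PowerSeries.X) * binomSeries (lam + 1) a *
      binomSeries (lam + 1) b) * hs' - (2 * PowerSeries.C (lam : ℂ) * PowerSeries.X *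
      (1 - PowerSeries.C a * PowerSeries.X) *
      (1 - PowerSeries.C b * PowerSeries.X) * binomSeries (lam + 1) a *
      binomSeries (lam + 1) b) * hab'
  have h0 : PowerSeries.coeff 0 F = 1 := by
    simp [hF, binomSeries, risingCoeff]
  have h1 : PowerSeries.coeff 1 F = 2 * lam * t := by
    have := congrArg (PowerSeries.coeff 0) key
    simp only [add_mul, sub_mul, one_mul, mul_assoc, map_add, map_sub, PowerSeries.coeff_C_mul,
      PowerSeries.coeff_zero_X_mul, pow_two, PowerSeries.coeff_derivative, h0] at this
    simpa [mul_assoc] using this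
  have hrec : ∀ n : ℕ, PowerSeries.coeff (n + 2) F = ((n : ℂ) + 2)⁻¹ *
      (2 * (n + 1 + lam) * (t * PowerSeries.coeff (n + 1) F) -
        (n + 2 * lam) * PowerSeries.coeff n F) := by
    intro n
    have h3 := congrArg (PowerSeries.coeff (n + 1)) key
    have h4 : (PowerSeries.coeff n) (PowerSeries.X * PowerSeries.derivative ℂ F) =
        n * PowerSeries.coeff n F := by
      cases n with
      | zero => simp
      | succ n =>
        rw [PowerSeries.coeff_succ_X_mul, PowerSeries.coeff_derivative]; push_cast; ring
    simp only [add_mul, sub_mul, one_mul, mul_assoc, map_add, map_sub, PowerSeries.coeff_C_mul,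
      PowerSeries.coeff_succ_X_mul, pow_two, PowerSeries.coeff_derivative, h4] at h3
    have hn : (n : ℂ) + 2 ≠ 0 := by exact_mod_cast (by positivity : (n : ℝ) + 2 ≠ 0)
    field_simp
    push_cast at h3
    linear_combination h3
  induction k using Nat.twoStepInduction with
  | zero => simpa [gegenbauer] using h0
  | one => simpa [gegenbauer] using h1
  | more n ih0 ih1 =>
    rw [hrec, ih0, ih1, gegenbauer]
    simp

/-- The formal Poisson kernel identity
`(1 - z²) (1 - 2 t z + z²) ^ (-lam - 1) = Σ (k + lam) / lam C_k z ^ k`. -/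
theorem coeff_poisson {lam : ℝ} (hl : 0 < lam) {a b : ℂ} {t : ℝ} (hab : a * b = 1)
    (hs : a + b = 2 * t) (k : ℕ) :
    PowerSeries.coeff k ((1 - PowerSeries.X ^ 2) *
      (binomSeries (lam + 1) a * binomSeries (lam + 1) b)) =
      (((k + lam) / lam * gegenbauer lam t 1 k : ℝ) : ℂ) := by
  have hl' : (lam : ℂ) ≠ 0 := by exact_mod_cast hl.ne'
  set F := binomSeries lam a * binomSeries lam b with hF
  have key : PowerSeries.C (lam : ℂ) * ((1 - PowerSeries.X ^ 2) *
      (binomSeries (lam + 1) a * binomSeries (lam + 1) b)) =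
      PowerSeries.X * PowerSeries.derivative ℂ F + PowerSeries.C (lam : ℂ) * F := by
    have hab' : (PowerSeries.C a * PowerSeries.C b : PowerSeries ℂ) = 1 := by
      rw [← map_mul, hab, map_one]
    rw [hF, Derivation.leibniz, derivative_binomSeries, derivative_binomSeries, smul_eq_mul,
      smul_eq_mul, ← one_sub_mul_binomSeries hl a, ← one_sub_mul_binomSeries hl b]
    simp only [map_mul]
    linear_combination (PowerSeries.C (lam : ℂ) * PowerSeries.X ^ 2 * binomSeries (lam + 1) a *
      binomSeries (lam + 1) b) * hab'
  have h4 : (PowerSeries.coeff k) (PowerSeries.X * PowerSeries.derivative ℂ F) =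
      k * PowerSeries.coeff k F := by
    cases k with
    | zero => simp
    | succ n =>
      rw [PowerSeries.coeff_succ_X_mul, PowerSeries.coeff_derivative]; push_cast; ring
  have h5 := congrArg (PowerSeries.coeff k) key
  have h6 : ((gegenbauer lam t 1 k : ℝ) : ℂ) = gegenbauer lam (t : ℂ) 1 k := by
    simpa using (AlgHom.map_gegenbauer (Algebra.ofId ℝ ℂ) lam t 1 k)
  rw [map_add, PowerSeries.coeff_C_mul, PowerSeries.coeff_C_mul, h4, hF,
    coeff_binomSeries_mul hl hab hs] at h5
  push_cast
  rw [h6]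
  field_simp
  linear_combination h5

theorem sum_risingCoeff_mul_gegenbauer {lam α : ℝ} (hl : 0 < lam) (hα : 0 < α) {a b : ℂ} {t : ℝ}
    (hab : a * b = 1) (hs : a + b = 2 * t) (n : ℕ) :
    ((∑ k ∈ Finset.range (n + 1), risingCoeff (α + 1) (n - k) *
      ((k + lam) / lam * gegenbauer lam t 1 k) : ℝ) : ℂ) =
    PowerSeries.coeff n (binomSeries α 1 * ((1 + PowerSeries.X) *
      (binomSeries (lam + 1) a * binomSeries (lam + 1) b))) := by
  have : binomSeries α 1 * ((1 + PowerSeries.X) *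
      (binomSeries (lam + 1) a * binomSeries (lam + 1) b)) =
      ((1 - PowerSeries.X ^ 2) *
      (binomSeries (lam + 1) a * binomSeries (lam + 1) b)) * binomSeries (α + 1) 1 := by
    rw [← one_sub_mul_binomSeries hα 1, map_one]
    ring
  rw [this, PowerSeries.coeff_mul, Finset.Nat.sum_antidiagonal_eq_sum_range_succ_mk,
    Complex.ofReal_sum]
  refine Finset.sum_congr rfl fun k _ => ?_
  rw [coeff_poisson hl hab hs]
  simp only [binomSeries, PowerSeries.coeff_mk]
  push_cast
  ring

/-! ### Cauchy estimates for products of binomial series -/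

/-- The power series `F` converges absolutely to `f` on the open unit disc. -/
def SumsOnDisc (F : PowerSeries ℂ) (f : ℂ → ℂ) : Prop :=
  ∀ z : ℂ, ‖z‖ < 1 → (Summable fun k => ‖PowerSeries.coeff k F * z ^ k‖) ∧
    ∑' k, PowerSeries.coeff k F * z ^ k = f z

theorem SumsOnDisc.mul {F G : PowerSeries ℂ} {f g : ℂ → ℂ} (hF : SumsOnDisc F f)
    (hG : SumsOnDisc G g) : SumsOnDisc (F * G) (fun z => f z * g z) := by
  intro z hz
  obtain ⟨hF1, hF2⟩ := hF z hz
  obtain ⟨hG1, hG2⟩ := hG z hz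
  have h : ∀ k, PowerSeries.coeff k (F * G) * z ^ k = ∑ p ∈ Finset.HasAntidiagonal.antidiagonal k,
      (PowerSeries.coeff p.1 F * z ^ p.1) * (PowerSeries.coeff p.2 G * z ^ p.2) := by
    intro k
    rw [PowerSeries.coeff_mul, Finset.sum_mul]
    refine Finset.sum_congr rfl fun p hp => ?_
    rw [← Finset.HasAntidiagonal.mem_antidiagonal.1 hp, pow_add]
    ring
  have hs := summable_norm_sum_mul_antidiagonal_of_summable_norm hF1 hG1
  have ht := tsum_mul_tsum_eq_tsum_sum_antidiagonal_of_summable_norm hF1 hG1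
  refine ⟨hs.congr fun k => congrArg norm (h k).symm, ?_⟩
  rw [hF2, hG2] at ht
  exact (tsum_congr h).trans ht.symm

theorem sumsOnDisc_one_add_X : SumsOnDisc (1 + PowerSeries.X) (fun z => 1 + z) := by
  intro z _
  have h0 : ∀ k ∉ Finset.range 2,
      PowerSeries.coeff k (1 + PowerSeries.X : PowerSeries ℂ) * z ^ k = 0 := by
    intro k hk
    simp only [Finset.mem_range, not_lt] at hk
    have h1 : k ≠ 0 := by omega
    have h2 : k ≠ 1 := by omega
    simp [PowerSeries.coeff_one, PowerSeries.coeff_X, h1, h2]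
  refine ⟨summable_of_ne_finset_zero (s := Finset.range 2) fun k hk => by rw [h0 k hk, norm_zero],
    ?_⟩
  rw [tsum_eq_sum h0]
  simp [Finset.sum_range_succ, PowerSeries.coeff_one, PowerSeries.coeff_X]

theorem ringChoose_eq_risingCoeff (μ : ℝ) (n : ℕ) :
    Ring.choose ((μ : ℂ) + n - 1) n = (risingCoeff μ n : ℂ) := by
  have h1 : ∀ n : ℕ, ((ascPochhammer ℕ n).smeval (μ : ℂ)) =
      (n.factorial : ℂ) * risingCoeff μ n := by
    intro n
    induction n with
    | zero => simp [risingCoeff]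
    | succ k ih =>
      have h : ((k : ℂ) + 1) ≠ 0 := by exact_mod_cast k.succ_ne_zero
      rw [ascPochhammer_succ_right, Polynomial.smeval_mul, ih, Polynomial.smeval_add,
        Polynomial.smeval_X, Polynomial.smeval_natCast, risingCoeff, Nat.factorial_succ]
      push_cast
      simp only [pow_one, pow_zero, nsmul_eq_mul, mul_one]
      field_simp
  have h2 := Ring.factorial_nsmul_multichoose_eq_ascPochhammer (μ : ℂ) n
  rw [h1, nsmul_eq_mul] at h2
  have h3 : (n.factorial : ℂ) ≠ 0 := by exact_mod_cast n.factorial_ne_zero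
  rw [Ring.choose, ← mul_left_cancel₀ h3 h2]
  congr 1
  ring

theorem mem_eball_zero_one_iff {z : ℂ} : z ∈ Metric.eball (0 : ℂ) 1 ↔ ‖z‖ < 1 := by
  rw [Metric.mem_eball, edist_zero_right, ← ofReal_norm, ENNReal.ofReal_lt_one]

theorem sumsOnDisc_binomSeries (μ : ℝ) {a : ℂ} (ha : ‖a‖ = 1) :
    SumsOnDisc (binomSeries μ a) (fun z => 1 / (1 - a * z) ^ (μ : ℂ)) := by
  intro z hz
  have hs := Complex.one_div_one_sub_cpow_hasFPowerSeriesOnBall_zero (μ : ℂ)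
  have hz' : a * z ∈ Metric.eball (0 : ℂ) 1 := by
    rwa [mem_eball_zero_one_iff, norm_mul, ha, one_mul]
  have h2 := hs.hasSum hz'
  have h3 := FormalMultilinearSeries.summable_norm_apply _ (Metric.eball_subset_eball hs.r_le hz')
  have h4 : ∀ k, PowerSeries.coeff k (binomSeries μ a) * z ^ k =
      (FormalMultilinearSeries.ofScalars ℂ fun n => Ring.choose ((μ : ℂ) + n - 1) n) k
        fun _ => a * z := by
    intro k
    simp [binomSeries, ringChoose_eq_risingCoeff]
    ring
  simp only [h4]
  refine ⟨h3, ?_⟩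
  rw [h2.tsum_eq, zero_add]

theorem SumsOnDisc.norm_coeff_le {F : PowerSeries ℂ} {f : ℂ → ℂ} (hF : SumsOnDisc F f) {r : ℝ}
    (hr0 : 0 < r) (hr1 : r < 1) (n : ℕ) :
    ‖PowerSeries.coeff n F‖ ≤
      ((2 * π)⁻¹ * ∫ θ : ℝ in 0..2 * π, ‖f (circleMap 0 r θ)‖) * r⁻¹ ^ n := by
  have hb : HasFPowerSeriesOnBall f
      (FormalMultilinearSeries.ofScalars ℂ fun n => PowerSeries.coeff n F) 0 1 := by
    refine ⟨?_, one_pos, ?_⟩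
    · refine ENNReal.le_of_forall_nnreal_lt fun s hs => ?_
      refine FormalMultilinearSeries.le_radius_of_summable_norm _ ?_
      have hs' : ‖((s : ℝ) : ℂ)‖ < 1 := by
        simpa using hs
      refine (hF _ hs').1.congr fun k => ?_
      rw [FormalMultilinearSeries.norm_apply_eq_norm_coef, FormalMultilinearSeries.coeff_ofScalars]
      simp
    · intro y hy
      obtain ⟨h1, h2⟩ := hF y (mem_eball_zero_one_iff.1 hy)
      rw [zero_add, ← h2]
      convert! h1.of_norm.hasSum using 2
      simp [mul_comm]
  lift r to ℝ≥0 using hr0.le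
  have hd : DifferentiableOn ℂ f (closedBall 0 r) := by
    intro z hz
    refine (hb.differentiableOn.differentiableAt ?_).differentiableWithinAt
    refine Metric.isOpen_eball.mem_nhds ?_
    rw [mem_closedBall, dist_zero_right] at hz
    exact mem_eball_zero_one_iff.2 (hz.trans_lt hr1)
  have hc := hd.hasFPowerSeriesOnBall (by exact_mod_cast hr0)
  have he := hb.hasFPowerSeriesAt.eq_formalMultilinearSeries hc.hasFPowerSeriesAt
  have h5 := norm_cauchyPowerSeries_le f 0 r n
  rw [← he, FormalMultilinearSeries.norm_apply_eq_norm_coef,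
    FormalMultilinearSeries.coeff_ofScalars, abs_of_pos hr0] at h5
  exact h5

theorem norm_one_sub_circleMap_ge {r : ℝ} (hr : 1 / 2 ≤ r) (hr1 : r < 1) {φ : ℝ} (hφ : |φ| ≤ π) :
    (1 - r + |φ|) / (2 * π) ≤ ‖1 - circleMap 0 r φ‖ := by
  have hπ := Real.pi_gt_three
  have h1 : 1 - r ≤ ‖1 - circleMap 0 r φ‖ := by
    have := norm_sub_norm_le (1 : ℂ) (circleMap 0 r φ)
    rwa [norm_one, norm_circleMap_zero, abs_of_pos (by linarith)] at this
  have h2 : |φ| / π ≤ ‖1 - circleMap 0 r φ‖ := by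
    refine abs_le_of_sq_le_sq' ?_ (norm_nonneg _) |>.2
    have h3 : ‖1 - circleMap 0 r φ‖ ^ 2 = (1 - r) ^ 2 + 2 * r * (1 - Real.cos φ) := by
      rw [← Complex.normSq_eq_norm_sq, Complex.normSq_apply]
      simp [circleMap, Complex.exp_re, Complex.exp_im]
      nlinarith [Real.sin_sq_add_cos_sq φ]
    have h4 := Real.cos_le_one_sub_mul_cos_sq hφ
    have h5 : (|φ| / π) ^ 2 = 1 / π ^ 2 * φ ^ 2 := by rw [div_pow, sq_abs]; ring
    have h6 : 0 ≤ 1 / π ^ 2 * φ ^ 2 := by positivity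
    have h7 : 2 / π ^ 2 * φ ^ 2 = 2 * (1 / π ^ 2 * φ ^ 2) := by ring
    rw [h3, h5]
    nlinarith [sq_nonneg (1 - r), mul_nonneg (by linarith : 0 ≤ r - 1 / 2)
      (by linarith : 0 ≤ 1 - Real.cos φ)]
  have h5 : (1 - r + |φ|) / (2 * π) = ((1 - r) / π + |φ| / π) / 2 := by field_simp
  have h6 : (1 - r) / π ≤ 1 - r := div_le_self (by linarith) (by linarith)
  rw [h5]
  linarith

theorem norm_one_sub_mul_circleMap_ge {r : ℝ} (hr : 0 < r) {a : ℂ}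
    (ha : ‖a‖ = 1) (φ : ℝ) : 1 - r ≤ ‖1 - a * circleMap 0 r φ‖ := by
  have := norm_sub_norm_le (1 : ℂ) (a * circleMap 0 r φ)
  rwa [norm_one, norm_mul, ha, norm_circleMap_zero, one_mul, abs_of_pos hr] at this

theorem continuous_norm_one_sub_mul_circleMap_rpow {r : ℝ} (hr : 0 < r) (hr1 : r < 1) {a : ℂ}
    (ha : ‖a‖ = 1) (p : ℝ) : Continuous fun φ => ‖1 - a * circleMap 0 r φ‖ ^ p := by
  refine Continuous.rpow_const (by fun_prop) fun φ => Or.inl ?_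
  have := norm_one_sub_mul_circleMap_ge hr ha φ
  exact (by linarith : 0 < ‖1 - a * circleMap 0 r φ‖).ne'

theorem integral_norm_one_sub_mul_circleMap_rpow_le {lam : ℝ} (hl : 0 < lam) {r : ℝ}
    (hr : 1 / 2 ≤ r) (hr1 : r < 1) {a : ℂ} (ha : ‖a‖ = 1) :
    ∫ φ in 0..2 * π, ‖1 - a * circleMap 0 r φ‖ ^ (-lam - 1) ≤
      ((2 * π) ^ (lam + 1) * (2 / lam)) * (1 - r) ^ (-lam) := by
  have hπ := Real.pi_pos
  obtain ⟨θ, rfl⟩ := (Complex.norm_eq_one_iff a).1 ha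
  set g : ℝ → ℝ := fun φ => ‖1 - circleMap 0 r φ‖ ^ (-lam - 1) with hg
  have hgc : Continuous g := by
    simpa using continuous_norm_one_sub_mul_circleMap_rpow (by linarith) hr1 (norm_one (α := ℂ))
      (-lam - 1)
  have hper : Function.Periodic g (2 * π) := fun φ => by
    simp only [hg, periodic_circleMap 0 r φ]
  have h1 : ∀ φ : ℝ, ‖1 - Complex.exp (θ * Complex.I) * circleMap 0 r φ‖ ^ (-lam - 1) =
      g (φ + θ) := by
    intro φ
    simp only [hg, circleMap, zero_add]
    congr 3
    rw [mul_left_comm, ← Complex.exp_add]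
    push_cast
    ring_nf
  simp only [h1]
  rw [intervalIntegral.integral_comp_add_right, zero_add, add_comm (2 * π) θ,
    hper.intervalIntegral_add_eq θ (-π)]
  set h : ℝ → ℝ := fun x => (2 * π) ^ (lam + 1) * x ^ (-lam - 1) with hh
  have hbound : ∀ φ, |φ| ≤ π → g φ ≤ h (1 - r + |φ|) := by
    intro φ hφ
    have h2 := norm_one_sub_circleMap_ge hr hr1 hφ
    have h3 : 0 < 1 - r + |φ| := by linarith [abs_nonneg φ]
    have h4 := Real.rpow_le_rpow_of_nonpos (by positivity) h2 (by linarith : -lam - 1 ≤ 0)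
    refine h4.trans (le_of_eq ?_)
    rw [hh, Real.div_rpow h3.le (by positivity), div_eq_mul_inv, ← Real.rpow_neg (by positivity)]
    rw [mul_comm]
    congr 2
    ring
  have hhc : ContinuousOn h (Set.Ioi 0) := by
    intro x hx
    refine ((Real.continuousAt_rpow_const x _ (Or.inl ?_)).const_mul _).continuousWithinAt
    exact (Set.mem_Ioi.1 hx).ne'
  have hcomp : Continuous fun φ : ℝ => h (1 - r + |φ|) :=
    hhc.comp_continuous (by fun_prop) fun φ => by
      rw [Set.mem_Ioi]; linarith [abs_nonneg φ]
  have h6 : (-π + 2 * π) = π := by ring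
  rw [h6]
  have h7 : ∫ φ in (0 : ℝ)..π, h (1 - r + |φ|) ≤ (2 * π) ^ (lam + 1) * (1 / lam) *
      (1 - r) ^ (-lam) := by
    have : ∫ φ in (0 : ℝ)..π, h (1 - r + |φ|) = ∫ φ in (0 : ℝ)..π, h (1 - r + φ) := by
      refine intervalIntegral.integral_congr fun x hx => ?_
      rw [Set.uIcc_of_le hπ.le] at hx
      simp only [abs_of_nonneg hx.1]
    rw [this, intervalIntegral.integral_comp_add_left, hh, intervalIntegral.integral_const_mul,
      integral_rpow, mul_assoc]
    · gcongr
      have h8 : -lam - 1 + 1 = -lam := by ring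
      rw [h8, add_zero, div_neg, ← neg_div, div_eq_inv_mul, one_div]
      gcongr
      have : 0 ≤ (1 - r + π) ^ (-lam) := by apply Real.rpow_nonneg; linarith
      linarith
    · right
      refine ⟨by linarith, fun h0 => ?_⟩
      rw [Set.uIcc_of_le (by linarith)] at h0
      linarith [h0.1]
  have h9 : ∫ φ in (-π)..0, h (1 - r + |φ|) = ∫ φ in (0 : ℝ)..π, h (1 - r + |φ|) := by
    have := intervalIntegral.integral_comp_neg (a := 0) (b := π) (fun φ => h (1 - r + |φ|))
    simp only [abs_neg, neg_zero] at this
    exact this.symm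
  calc ∫ φ in (-π)..π, g φ ≤ ∫ φ in (-π)..π, h (1 - r + |φ|) := by
        refine intervalIntegral.integral_mono_on (by linarith) (hgc.intervalIntegrable _ _)
          (hcomp.intervalIntegrable _ _) fun φ hφ => hbound φ (abs_le.2 hφ)
    _ = (∫ φ in (-π)..0, h (1 - r + |φ|)) + ∫ φ in (0 : ℝ)..π, h (1 - r + |φ|) :=
        (intervalIntegral.integral_add_adjacent_intervals (hcomp.intervalIntegrable _ _)
          (hcomp.intervalIntegrable _ _)).symm
    _ ≤ _ := by
        rw [h9]
        calc _ ≤ (2 * π) ^ (lam + 1) * (1 / lam) * (1 - r) ^ (-lam) +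
              (2 * π) ^ (lam + 1) * (1 / lam) * (1 - r) ^ (-lam) := add_le_add h7 h7
          _ = _ := by ring

/-! ### Bounds for the Cesàro kernels -/

theorem rpow_neg_mul_rpow_neg_mul_max_rpow_le {u v α β : ℝ} (hu : 0 < u) (hv : 0 < v)
    (hαβ : α ≤ β) :
    u ^ (-α) * v ^ (-β) * (max u v) ^ α ≤ u ^ (-β) + v ^ (-β) := by
  rcases le_total u v with h | h
  · rw [max_eq_right h]
    have h1 : u ^ (-α) * v ^ (-β) * v ^ α = u ^ (-β) * (u / v) ^ (β - α) := by
      rw [Real.div_rpow hu.le hv.le, div_eq_mul_inv, ← Real.rpow_neg hv.le, mul_assoc,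
        ← Real.rpow_add hv, ← mul_assoc, ← Real.rpow_add hu]
      congr 2 <;> ring
    rw [h1]
    have h2 : (u / v) ^ (β - α) ≤ 1 :=
      Real.rpow_le_one (by positivity) (div_le_one_of_le₀ h hv.le) (by linarith)
    have h3 : 0 ≤ u ^ (-β) := by positivity
    have h4 : 0 ≤ v ^ (-β) := by positivity
    nlinarith
  · rw [max_eq_left h, mul_right_comm, ← Real.rpow_add hu, neg_add_cancel, Real.rpow_zero, one_mul]
    have h3 : 0 ≤ u ^ (-β) := by positivity
    linarith

theorem poisson_singularity_le_of_le {lam α u v w D E s : ℝ} (hl : 0 < lam) (hα : 0 ≤ α)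
    (hα1 : α ≤ lam + 1) (hu : 0 < u) (hv : 0 < v) (hvw : v ≤ w) (hD : 0 ≤ D) (hD2 : D ≤ 2)
    (hE : 0 ≤ E) (h1 : D ≤ u + v) (h2 : D * E ≤ v + w) (h3 : s ≤ E + v) :
    u ^ (-α) * (s * (v ^ (-lam - 1) * w ^ (-lam - 1))) * (D ^ (1 + lam + α) * E ^ lam) ≤
      4 * 2 ^ lam * 2 ^ α * (u ^ (-lam - 1) + v ^ (-lam - 1)) := by
  have hw : 0 < w := hv.trans_le hvw
  have e1 : D ^ (1 + lam + α) * E ^ lam = D * (D * E) ^ lam * D ^ α := by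
    rw [Real.mul_rpow hD hE, Real.rpow_add_of_nonneg hD (by linarith) hα,
      Real.rpow_add_of_nonneg hD (by linarith) hl.le, Real.rpow_one]
    ring
  have e2 : D * s * (D * E) ^ lam * w ^ (-lam - 1) ≤ 4 * 2 ^ lam := by
    have f1 : D * s ≤ 4 * w := by nlinarith
    have f2 : (D * E) ^ lam ≤ (2 * w) ^ lam := by
      apply Real.rpow_le_rpow (by positivity) (by linarith) hl.le
    calc D * s * (D * E) ^ lam * w ^ (-lam - 1) ≤ 4 * w * (2 * w) ^ lam * w ^ (-lam - 1) := by
          gcongr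
      _ = 4 * 2 ^ lam * (w * w ^ lam * w ^ (-lam - 1)) := by
          rw [Real.mul_rpow (by norm_num) hw.le]; ring
      _ = 4 * 2 ^ lam := by
          rw [mul_comm w, ← Real.rpow_add_one hw.ne', ← Real.rpow_add hw]
          simp
  have e3 : D ^ α ≤ 2 ^ α * (max u v) ^ α := by
    rw [← Real.mul_rpow (by norm_num) (by positivity)]
    apply Real.rpow_le_rpow hD _ hα
    linarith [le_max_left u v, le_max_right u v]
  have e4 := rpow_neg_mul_rpow_neg_mul_max_rpow_le hu hv hα1
  have e5 : -(lam + 1) = -lam - 1 := by ring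
  rw [e5] at e4
  calc u ^ (-α) * (s * (v ^ (-lam - 1) * w ^ (-lam - 1))) * (D ^ (1 + lam + α) * E ^ lam)
      = (D * s * (D * E) ^ lam * w ^ (-lam - 1)) * (u ^ (-α) * v ^ (-lam - 1) * D ^ α) := by
        rw [e1]; ring
    _ ≤ (4 * 2 ^ lam) * (u ^ (-α) * v ^ (-lam - 1) * (2 ^ α * (max u v) ^ α)) := by
        gcongr
    _ = 4 * 2 ^ lam * 2 ^ α * (u ^ (-α) * v ^ (-lam - 1) * (max u v) ^ α) := by ring
    _ ≤ _ := by gcongr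

theorem poisson_singularity_le {lam α u v w D E s : ℝ} (hl : 0 < lam) (hα : 0 ≤ α)
    (hα1 : α ≤ lam + 1) (hu : 0 < u) (hv : 0 < v) (hw : 0 < w) (hD : 0 ≤ D) (hD2 : D ≤ 2)
    (hE : 0 ≤ E) (h1 : D ≤ u + v) (h1' : D ≤ u + w) (h2 : D * E ≤ v + w)
    (h3 : s ≤ E + v) (h3' : s ≤ E + w) :
    u ^ (-α) * (s * (v ^ (-lam - 1) * w ^ (-lam - 1))) * (D ^ (1 + lam + α) * E ^ lam) ≤
      4 * 2 ^ lam * 2 ^ α * (u ^ (-lam - 1) + v ^ (-lam - 1) + w ^ (-lam - 1)) := by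
  have k0 : 0 ≤ 4 * 2 ^ lam * 2 ^ α * v ^ (-lam - 1) := by positivity
  have k1 : 0 ≤ 4 * 2 ^ lam * 2 ^ α * w ^ (-lam - 1) := by positivity
  rcases le_total v w with h | h
  · have := poisson_singularity_le_of_le hl hα hα1 hu hv h hD hD2 hE h1 h2 h3
    linarith
  · have := poisson_singularity_le_of_le hl hα hα1 hu hw h hD hD2 hE h1' (by linarith) h3'
    rw [mul_comm (v ^ (-lam - 1))]
    linarith

theorem exists_unit_complex_of_mem_Icc {t : ℝ} (h0 : -1 ≤ t) (h1 : t ≤ 1) :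
    ∃ a b : ℂ, ‖a‖ = 1 ∧ ‖b‖ = 1 ∧ a * b = 1 ∧ a + b = 2 * t ∧ ‖1 - a‖ = √(2 - 2 * t) ∧
      ‖1 - b‖ = √(2 - 2 * t) ∧ ‖1 + a‖ = √(2 + 2 * t) ∧ ‖1 + b‖ = √(2 + 2 * t) ∧
      ‖a - b‖ = √(2 - 2 * t) * √(2 + 2 * t) := by
  have hq : √(1 - t ^ 2) ^ 2 = 1 - t ^ 2 := Real.sq_sqrt (by nlinarith)
  set q := √(1 - t ^ 2)
  have key : ∀ x y z : ℝ, x ^ 2 + y ^ 2 = z → ∀ w : ℂ, w.re = x → w.im = y → ‖w‖ = √z := by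
    intro x y z h w hx hy
    rw [← Real.sqrt_sq (norm_nonneg w), ← Complex.normSq_eq_norm_sq, Complex.normSq_apply, hx, hy,
      ← h]
    ring_nf
  refine ⟨⟨t, q⟩, ⟨t, -q⟩, ?_, ?_, ?_, ?_, ?_, ?_, ?_, ?_, ?_⟩
  · rw [key t q 1 (by linarith) _ rfl rfl, Real.sqrt_one]
  · rw [key t (-q) 1 (by linarith) _ rfl rfl, Real.sqrt_one]
  · apply Complex.ext <;> simp <;> nlinarith
  · apply Complex.ext <;> simp; ring
  · exact key (1 - t) (-q) _ (by linarith) _ (by simp) (by simp)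
  · exact key (1 - t) q _ (by linarith) _ (by simp) (by simp)
  · exact key (1 + t) q _ (by linarith) _ (by simp) (by simp)
  · exact key (1 + t) (-q) _ (by linarith) _ (by simp) (by simp)
  · rw [← Real.sqrt_mul (by linarith)]
    exact key 0 (2 * q) _ (by linarith) _ (by simp) (by simp; ring)

theorem exists_rpow_le_mul_cesaroA {α : ℝ} (hα : 0 < α) :
    ∃ c : ℝ, 0 < c ∧ ∀ n : ℕ, 1 ≤ n → ((n : ℝ) + 1) ^ α ≤ c * cesaroA α n := by
  have h := (Real.GammaSeq_tendsto_Gamma α).bddAbove_range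
  obtain ⟨M, hM⟩ := h
  have hpos := fun n => risingCoeff_pos (μ := α + 1) (by linarith) n
  have hM0 : 0 ≤ M := by
    refine le_trans ?_ (hM ⟨1, rfl⟩)
    rw [Real.GammaSeq]
    positivity
  have hseq : ∀ n : ℕ, (n : ℝ) ^ α = α * Real.GammaSeq α n * risingCoeff (α + 1) n := by
    intro n
    have h1 : ∀ n : ℕ, ∏ j ∈ Finset.range (n + 1), (α + j) =
        α * n.factorial * risingCoeff (α + 1) n := by
      intro n
      induction n with
      | zero => simp [risingCoeff]
      | succ n ih =>
        rw [Finset.prod_range_succ, ih, Nat.factorial_succ, risingCoeff]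
        push_cast
        field_simp
        ring
    have h2 : (n.factorial : ℝ) ≠ 0 := by positivity
    rw [Real.GammaSeq, h1]
    have := (hpos n).ne'
    field_simp
  refine ⟨2 ^ α * (α * M + 1), by positivity, fun n hn => ?_⟩
  rw [cesaroA_eq_risingCoeff hα]
  have hn' : (1 : ℝ) ≤ n := by exact_mod_cast hn
  calc ((n : ℝ) + 1) ^ α ≤ (2 * n) ^ α := by
        apply Real.rpow_le_rpow (by positivity) (by linarith) hα.le
    _ = 2 ^ α * (α * Real.GammaSeq α n * risingCoeff (α + 1) n) := by
        rw [Real.mul_rpow (by norm_num) (by positivity), hseq]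
    _ ≤ 2 ^ α * (α * M * risingCoeff (α + 1) n) := by
        have := hM ⟨n, rfl⟩
        have := (hpos n).le
        gcongr
    _ ≤ _ := by
        have h3 : 0 ≤ (2 : ℝ) ^ α * risingCoeff (α + 1) n := mul_nonneg (by positivity) (hpos n).le
        linarith

theorem inv_one_sub_inv_pow_le {n : ℕ} (hn : 1 ≤ n) :
    (1 - 1 / ((n : ℝ) + 1))⁻¹ ^ n ≤ Real.exp 1 := by
  have hn' : (0 : ℝ) < n := by exact_mod_cast hn
  have h : (1 - 1 / ((n : ℝ) + 1))⁻¹ = 1 / n + 1 := by field_simp; simp [hn'.ne', add_comm]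
  rw [h]
  calc (1 / (n : ℝ) + 1) ^ n ≤ (Real.exp (1 / n)) ^ n := by
        gcongr; exact Real.add_one_le_exp _
    _ = Real.exp 1 := by rw [← Real.exp_nat_mul]; congr 1; field_simp

theorem norm_poisson_prod {lam α : ℝ} (a b z : ℂ) :
    ‖1 / (1 - 1 * z) ^ (α : ℂ) * ((1 + z) * (1 / (1 - a * z) ^ ((lam + 1 : ℝ) : ℂ) *
      (1 / (1 - b * z) ^ ((lam + 1 : ℝ) : ℂ))))‖ =
    ‖1 - 1 * z‖ ^ (-α) * (‖1 + z‖ * (‖1 - a * z‖ ^ (-lam - 1) * ‖1 - b * z‖ ^ (-lam - 1))) := by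
  have h : -lam - 1 = -(lam + 1) := by ring
  simp only [h, Real.rpow_neg (norm_nonneg _), one_div, norm_mul, norm_inv, Complex.norm_cpow_real]

/-- The kernel of the Cesàro means of order `α` as a function of `t = ⟪x, y⟫`, up to a
normalizing constant. -/
def zonalKernel (lam α : ℝ) (n : ℕ) (t : ℝ) : ℝ :=
  (cesaroA α n)⁻¹ * ∑ k ∈ Finset.range (n + 1), cesaroA α (n - k) *
    ((k + lam) / lam * gegenbauer lam t 1 k)

theorem exists_zonalKernel_bound {lam α : ℝ} (hl : 0 < lam) (hα : lam < α) :
    ∃ C : ℝ, 0 ≤ C ∧ ∀ n : ℕ, 1 ≤ n → ∀ t : ℝ, -1 ≤ t → t ≤ 1 →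
      |zonalKernel lam α n t| ≤ C * (1 / ((n : ℝ) + 1)) ^ (-(2 * lam + 1)) ∧
      |zonalKernel lam α n t| *
        (√(2 - 2 * t) ^ (2 * lam + 1 + min (α - lam) 1) * √(2 + 2 * t) ^ lam) ≤
        C * (1 / ((n : ℝ) + 1)) ^ (min (α - lam) 1) := by
  have hα0 : 0 < α := hl.trans hα
  obtain ⟨c, hc, hcA⟩ := exists_rpow_le_mul_cesaroA hα0
  set α' := lam + min (α - lam) 1 with hα'
  have hα'1 : α' ≤ lam + 1 := by rw [hα']; linarith [min_le_right (α - lam) 1]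
  have hα'2 : α' ≤ α := by rw [hα']; linarith [min_le_left (α - lam) 1]
  have hα'0 : 0 ≤ α' := by
    have : 0 ≤ min (α - lam) 1 := le_min (by linarith) zero_le_one
    rw [hα']; linarith
  set B := (2 * π) ^ (lam + 1) * (2 / lam) with hB
  have hB0 : 0 ≤ B := by have := Real.pi_pos; positivity
  set M := 4 * (2 : ℝ) ^ lam * 2 ^ α' * 3 * B + 2 * B with hM
  have hM1 : 4 * (2 : ℝ) ^ lam * 2 ^ α' * 3 * B ≤ M := by linarith
  have hM2 : 2 * B ≤ M := by
    have : 0 ≤ 4 * (2 : ℝ) ^ lam * 2 ^ α' * 3 * B := by positivity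
    linarith
  have hM0 : 0 ≤ M := by linarith
  have hπ := Real.pi_pos
  refine ⟨c * (2 * π)⁻¹ * Real.exp 1 * M, by positivity, fun n hn t ht0 ht1 => ?_⟩
  have hn' : (1 : ℝ) ≤ n := by exact_mod_cast hn
  obtain ⟨a, b, ha, hb, hab, hs, ha1, hb1, ha2, hb2, hab2⟩ := exists_unit_complex_of_mem_Icc ht0 ht1
  set D := √(2 - 2 * t)
  set E := √(2 + 2 * t)
  have hD0 : 0 ≤ D := Real.sqrt_nonneg _
  have hE0 : 0 ≤ E := Real.sqrt_nonneg _
  have hD2 : D ≤ 2 := by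
    rw [← ha1]; refine (norm_sub_le _ _).trans ?_; rw [ha, norm_one]; norm_num
  set ε := 1 / ((n : ℝ) + 1) with hε
  have hε0 : 0 < ε := by positivity
  have hε1 : ε ≤ 1 / 2 := by
    rw [hε]; apply one_div_le_one_div_of_le <;> linarith
  set r := 1 - ε with hr
  have hr0 : 0 < r := by linarith
  have hr1 : r < 1 := by linarith
  have hrε : 1 - r = ε := by rw [hr]; ring
  have hsum := (sumsOnDisc_binomSeries α norm_one).mul (sumsOnDisc_one_add_X.mul
    ((sumsOnDisc_binomSeries (lam + 1) ha).mul (sumsOnDisc_binomSeries (lam + 1) hb)))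
  have hcoef := hsum.norm_coeff_le hr0 hr1 n
  rw [← sum_risingCoeff_mul_gegenbauer hl hα0 hab hs, Complex.norm_real, Real.norm_eq_abs] at hcoef
  simp only [norm_poisson_prod] at hcoef
  simp only [← cesaroA_eq_risingCoeff hα0] at hcoef
  set g : ℝ → ℝ := fun θ => ‖1 - 1 * circleMap 0 r θ‖ ^ (-α) * (‖1 + circleMap 0 r θ‖ *
    (‖1 - a * circleMap 0 r θ‖ ^ (-lam - 1) * ‖1 - b * circleMap 0 r θ‖ ^ (-lam - 1))) with hg
  have hcu := fun p => continuous_norm_one_sub_mul_circleMap_rpow hr0 hr1 (norm_one (α := ℂ)) p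
  have hca := fun p => continuous_norm_one_sub_mul_circleMap_rpow hr0 hr1 ha p
  have hcb := fun p => continuous_norm_one_sub_mul_circleMap_rpow hr0 hr1 hb p
  have hgc : Continuous g := by
    refine (hcu _).mul (Continuous.mul (by fun_prop) ((hca _).mul (hcb _)))
  have hIu := integral_norm_one_sub_mul_circleMap_rpow_le hl (by linarith) hr1 (norm_one (α := ℂ))
  have hIa := integral_norm_one_sub_mul_circleMap_rpow_le hl (by linarith) hr1 ha
  have hIb := integral_norm_one_sub_mul_circleMap_rpow_le hl (by linarith) hr1 hb
  rw [hrε, ← hB] at hIu hIa hIb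
  have hlow : ∀ {a : ℂ}, ‖a‖ = 1 → ∀ θ, ε ≤ ‖1 - a * circleMap 0 r θ‖ := fun ha θ => by
    have := norm_one_sub_mul_circleMap_ge hr0 ha θ
    rwa [hrε] at this
  have hI1 : ∫ θ in 0..2 * π, g θ ≤ M * ε ^ (-α - (2 * lam + 1)) := by
    have hp : ∀ θ, g θ ≤ 2 * ε ^ (-α) * ε ^ (-lam - 1) * ‖1 - a * circleMap 0 r θ‖ ^ (-lam - 1) := by
      intro θ
      have h1 := Real.rpow_le_rpow_of_nonpos hε0 (hlow norm_one θ) (by linarith : -α ≤ 0)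
      have h2 := Real.rpow_le_rpow_of_nonpos hε0 (hlow hb θ) (by linarith : -lam - 1 ≤ 0)
      have h3 : ‖1 + circleMap 0 r θ‖ ≤ 2 := by
        refine (norm_add_le _ _).trans ?_
        rw [norm_one, norm_circleMap_zero, abs_of_pos hr0]; linarith
      calc g θ ≤ ε ^ (-α) * (2 * (‖1 - a * circleMap 0 r θ‖ ^ (-lam - 1) * ε ^ (-lam - 1))) := by
            simp only [hg]; gcongr
        _ = _ := by ring
    calc ∫ θ in 0..2 * π, g θ ≤ ∫ θ in 0..2 * π,
          2 * ε ^ (-α) * ε ^ (-lam - 1) * ‖1 - a * circleMap 0 r θ‖ ^ (-lam - 1) := by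
          refine intervalIntegral.integral_mono_on (by positivity) (hgc.intervalIntegrable _ _)
            (((hca _).const_mul _).intervalIntegrable _ _) fun θ _ => hp θ
      _ ≤ 2 * ε ^ (-α) * ε ^ (-lam - 1) * (B * ε ^ (-lam)) := by
          rw [intervalIntegral.integral_const_mul]; gcongr
      _ = 2 * B * ε ^ (-α - (2 * lam + 1)) := by
          have : -α - (2 * lam + 1) = -α + (-lam - 1) + -lam := by ring
          rw [this, Real.rpow_add hε0, Real.rpow_add hε0]; ring
      _ ≤ _ := by gcongr
  have hI2 : (∫ θ in 0..2 * π, g θ) * (D ^ (1 + lam + α') * E ^ lam) ≤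
      M * ε ^ (-α + min (α - lam) 1) := by
    have hp : ∀ θ, g θ * (D ^ (1 + lam + α') * E ^ lam) ≤ ε ^ (-(α - α')) *
        (4 * 2 ^ lam * 2 ^ α') * (‖1 - 1 * circleMap 0 r θ‖ ^ (-lam - 1) +
          ‖1 - a * circleMap 0 r θ‖ ^ (-lam - 1) + ‖1 - b * circleMap 0 r θ‖ ^ (-lam - 1)) := by
      intro θ
      simp only [hg]
      have hu := hlow (norm_one (α := ℂ)) θ
      have hv := hlow ha θ
      have hw := hlow hb θ
      have ev : ‖1 - a * circleMap 0 r θ‖ = ‖b - circleMap 0 r θ‖ := by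
        rw [show 1 - a * circleMap 0 r θ = a * (b - circleMap 0 r θ) by rw [mul_sub, hab],
          norm_mul, ha, one_mul]
      have ew : ‖1 - b * circleMap 0 r θ‖ = ‖a - circleMap 0 r θ‖ := by
        rw [show 1 - b * circleMap 0 r θ = b * (a - circleMap 0 r θ) by
          rw [mul_sub, mul_comm b a, hab], norm_mul, hb, one_mul]
      set z := circleMap 0 r θ
      rw [one_mul] at hu ⊢
      have k1 : D ≤ ‖1 - z‖ + ‖1 - a * z‖ := by
        rw [ev, ← hb1, norm_sub_rev b z]; exact norm_sub_le_norm_sub_add_norm_sub _ _ _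
      have k2 : D ≤ ‖1 - z‖ + ‖1 - b * z‖ := by
        rw [ew, ← ha1, norm_sub_rev a z]; exact norm_sub_le_norm_sub_add_norm_sub _ _ _
      have k3 : D * E ≤ ‖1 - a * z‖ + ‖1 - b * z‖ := by
        rw [ev, ew, ← hab2, norm_sub_rev b z, add_comm]
        exact norm_sub_le_norm_sub_add_norm_sub _ _ _
      have k4 : ‖1 + z‖ ≤ E + ‖1 - a * z‖ := by
        rw [ev, ← hb2]
        calc ‖1 + z‖ = ‖(1 + b) - (b - z)‖ := by congr 1; ring
          _ ≤ _ := norm_sub_le _ _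
      have k5 : ‖1 + z‖ ≤ E + ‖1 - b * z‖ := by
        rw [ew, ← ha2]
        calc ‖1 + z‖ = ‖(1 + a) - (a - z)‖ := by congr 1; ring
          _ ≤ _ := norm_sub_le _ _
      have main := poisson_singularity_le hl hα'0 hα'1 (hε0.trans_le hu) (hε0.trans_le hv)
        (hε0.trans_le hw) hD0 hD2 hE0 k1 k2 k3 k4 k5
      have hu2 : ‖1 - z‖ ^ (-α) ≤ ε ^ (-(α - α')) * ‖1 - z‖ ^ (-α') := by
        have e : -α = -(α - α') + -α' := by ring
        rw [e, Real.rpow_add (hε0.trans_le hu)]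
        gcongr ?_ * _
        exact Real.rpow_le_rpow_of_nonpos hε0 hu (by linarith)
      calc _ ≤ (ε ^ (-(α - α')) * ‖1 - z‖ ^ (-α')) * (‖1 + z‖ * (‖1 - a * z‖ ^ (-lam - 1) *
            ‖1 - b * z‖ ^ (-lam - 1))) * (D ^ (1 + lam + α') * E ^ lam) := by gcongr
        _ = ε ^ (-(α - α')) * (‖1 - z‖ ^ (-α') * (‖1 + z‖ * (‖1 - a * z‖ ^ (-lam - 1) *
            ‖1 - b * z‖ ^ (-lam - 1))) * (D ^ (1 + lam + α') * E ^ lam)) := by ring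
        _ ≤ _ := by
          rw [mul_assoc (ε ^ (-(α - α')))]
          gcongr
    rw [← intervalIntegral.integral_mul_const]
    calc _ ≤ ∫ θ in 0..2 * π, ε ^ (-(α - α')) *
        (4 * 2 ^ lam * 2 ^ α') * (‖1 - 1 * circleMap 0 r θ‖ ^ (-lam - 1) +
          ‖1 - a * circleMap 0 r θ‖ ^ (-lam - 1) + ‖1 - b * circleMap 0 r θ‖ ^ (-lam - 1)) := by
          refine intervalIntegral.integral_mono_on (by positivity)
            ((hgc.mul_const _).intervalIntegrable _ _)
            (((((hcu _).add (hca _)).add (hcb _)).const_mul _).intervalIntegrable _ _)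
            fun θ _ => hp θ
      _ ≤ ε ^ (-(α - α')) * (4 * 2 ^ lam * 2 ^ α') *
          (B * ε ^ (-lam) + B * ε ^ (-lam) + B * ε ^ (-lam)) := by
          rw [intervalIntegral.integral_const_mul, intervalIntegral.integral_add,
            intervalIntegral.integral_add]
          · gcongr
          · exact (hcu _).intervalIntegrable _ _
          · exact (hca _).intervalIntegrable _ _
          · exact ((hcu _).add (hca _)).intervalIntegrable _ _
          · exact (hcb _).intervalIntegrable _ _
      _ = 4 * (2 : ℝ) ^ lam * 2 ^ α' * 3 * B * ε ^ (-α + min (α - lam) 1) := by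
          have : -α + min (α - lam) 1 = -(α - α') + -lam := by rw [hα']; ring
          rw [this, Real.rpow_add hε0]; ring
      _ ≤ _ := by gcongr
  have hA : (cesaroA α n)⁻¹ ≤ c * ε ^ α := by
    have hp : 0 < cesaroA α n := by
      rw [cesaroA_eq_risingCoeff hα0]; exact risingCoeff_pos (by linarith) n
    have h1 := hcA n hn
    have h2 : ε ^ α = (((n : ℝ) + 1) ^ α)⁻¹ := by
      rw [hε, one_div, Real.inv_rpow (by positivity)]
    have h3 : 0 < ((n : ℝ) + 1) ^ α := by positivity
    rw [h2, inv_le_iff_one_le_mul₀ hp, mul_right_comm, ← div_eq_mul_inv, one_le_div h3]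
    exact h1
  have hA0 : 0 ≤ (cesaroA α n)⁻¹ := by
    rw [cesaroA_eq_risingCoeff hα0]; exact inv_nonneg.2 (risingCoeff_pos (by linarith) n).le
  have hI0 : 0 ≤ ∫ θ in 0..2 * π, g θ :=
    intervalIntegral.integral_nonneg (by positivity) fun θ _ => by simp only [hg]; positivity
  have hK : |zonalKernel lam α n t| ≤
      c * ε ^ α * (((2 * π)⁻¹ * ∫ θ in 0..2 * π, g θ) * Real.exp 1) := by
    rw [zonalKernel, abs_mul, abs_of_nonneg hA0]
    have := inv_one_sub_inv_pow_le hn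
    gcongr
    refine hcoef.trans ?_
    gcongr
  constructor
  · calc _ ≤ _ := hK
      _ ≤ c * ε ^ α * (((2 * π)⁻¹ * (M * ε ^ (-α - (2 * lam + 1)))) * Real.exp 1) := by gcongr
      _ = c * (2 * π)⁻¹ * Real.exp 1 * M * (ε ^ α * ε ^ (-α - (2 * lam + 1))) := by ring
      _ = _ := by rw [← Real.rpow_add hε0]; congr 2; ring
  · have e : 2 * lam + 1 + min (α - lam) 1 = 1 + lam + α' := by rw [hα']; ring
    rw [e]
    calc _ ≤ c * ε ^ α * (((2 * π)⁻¹ * ∫ θ in 0..2 * π, g θ) * Real.exp 1) *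
          (D ^ (1 + lam + α') * E ^ lam) := by gcongr
      _ = c * ε ^ α * (((2 * π)⁻¹ * ((∫ θ in 0..2 * π, g θ) * (D ^ (1 + lam + α') * E ^ lam))) *
          Real.exp 1) := by ring
      _ ≤ c * ε ^ α * (((2 * π)⁻¹ * (M * ε ^ (-α + min (α - lam) 1))) * Real.exp 1) := by gcongr
      _ = c * (2 * π)⁻¹ * Real.exp 1 * M * (ε ^ α * ε ^ (-α + min (α - lam) 1)) := by ring
      _ = _ := by rw [← Real.rpow_add hε0]; congr 2; ring

/-! ### Zonal harmonic polynomials -/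

section Polynomial

open MvPolynomial

variable {ι : Type*} [Fintype ι]

/-- The Euclidean Laplacian on polynomials. -/
def polyLaplacian (F : MvPolynomial ι ℝ) : MvPolynomial ι ℝ :=
  ∑ i, pderiv i (pderiv i F)

/-- The derivative of polynomials in the direction `y`. -/
def dirDeriv (y : ι → ℝ) : Derivation ℝ (MvPolynomial ι ℝ) (MvPolynomial ι ℝ) :=
  ∑ i, (C (y i) : MvPolynomial ι ℝ) • pderiv i

/-- The linear form `x ↦ ⟪x, y⟫` as a polynomial. -/
def linForm (y : ι → ℝ) : MvPolynomial ι ℝ := ∑ i, C (y i) * X i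

/-- The polynomial `x ↦ ‖x‖²`. -/
def sqNormPoly (ι : Type*) [Fintype ι] : MvPolynomial ι ℝ := ∑ i, X i * X i

theorem dirDeriv_apply (y : ι → ℝ) (F : MvPolynomial ι ℝ) :
    dirDeriv y F = ∑ i, C (y i) * pderiv i F := by
  rw [dirDeriv, ← Derivation.coeFnAddMonoidHom_apply, map_sum, Finset.sum_apply]
  rfl

theorem pderiv_linForm (y : ι → ℝ) (i : ι) : pderiv i (linForm y) = C (y i) := by
  classical
  simp [linForm, pderiv_X, Pi.single_apply]

theorem pderiv_sqNormPoly (i : ι) : pderiv i (sqNormPoly ι) = 2 * X i := by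
  classical
  simp [sqNormPoly, pderiv_X, Pi.single_apply, two_mul, Finset.sum_add_distrib]

theorem dirDeriv_linForm {y : ι → ℝ} (hy : ∑ i, y i ^ 2 = 1) : dirDeriv y (linForm y) = 1 := by
  rw [dirDeriv_apply, ← map_one C, ← hy, map_sum]
  exact Finset.sum_congr rfl fun i _ => by rw [pderiv_linForm, ← map_mul, pow_two]

theorem dirDeriv_sqNormPoly (y : ι → ℝ) : dirDeriv y (sqNormPoly ι) = 2 * linForm y := by
  simp only [dirDeriv_apply, pderiv_sqNormPoly, linForm, Finset.mul_sum]
  exact Finset.sum_congr rfl fun i _ => by ring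

theorem polyLaplacian_add (F G : MvPolynomial ι ℝ) :
    polyLaplacian (F + G) = polyLaplacian F + polyLaplacian G := by
  simp [polyLaplacian, Finset.sum_add_distrib]

theorem polyLaplacian_smul (c : ℝ) (F : MvPolynomial ι ℝ) :
    polyLaplacian (c • F) = c • polyLaplacian F := by
  simp [polyLaplacian, Finset.smul_sum]

theorem polyLaplacian_linForm_mul (y : ι → ℝ) (F : MvPolynomial ι ℝ) :
    polyLaplacian (linForm y * F) = linForm y * polyLaplacian F + 2 * dirDeriv y F := by
  simp only [polyLaplacian, dirDeriv_apply, pderiv_mul, pderiv_linForm, map_add, pderiv_C,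
    Finset.mul_sum, ← Finset.sum_add_distrib]
  exact Finset.sum_congr rfl fun i _ => by ring

theorem polyLaplacian_sqNormPoly_mul {F : MvPolynomial ι ℝ} {k : ℕ} (hF : F.IsHomogeneous k) :
    polyLaplacian (sqNormPoly ι * F) = sqNormPoly ι * polyLaplacian F +
      (4 * (k : ℝ) + 2 * Fintype.card ι) • F := by
  have h := hF.sum_X_mul_pderiv
  have h1 : polyLaplacian (sqNormPoly ι * F) = sqNormPoly ι * polyLaplacian F +
      4 * (∑ i, X i * pderiv i F) + ∑ _i : ι, 2 * F := by
    simp only [polyLaplacian, pderiv_mul, pderiv_sqNormPoly, map_add, Finset.mul_sum,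
      ← Finset.sum_add_distrib]
    refine Finset.sum_congr rfl fun i _ => ?_
    have h2 : pderiv i (2 : MvPolynomial ι ℝ) = 0 := by
      rw [← map_ofNat C 2, pderiv_C]
    rw [pderiv_X_self, h2]
    ring
  rw [h1, h, Finset.sum_const, Finset.card_univ, add_assoc]
  congr 1
  simp only [nsmul_eq_mul, MvPolynomial.smul_eq_C_mul, map_add, map_mul, map_natCast, map_ofNat]
  ring

theorem pderiv_comm {ι : Type*} (i j : ι) (F : MvPolynomial ι ℝ) :
    pderiv i (pderiv j F) = pderiv j (pderiv i F) := by
  classical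
  rcases eq_or_ne i j with rfl | h
  · rfl
  · ext m
    simp only [coeff_pderiv, Finsupp.add_apply, Finsupp.single_apply, if_neg h, if_neg h.symm,
      add_right_comm m]
    ring_nf

theorem polyLaplacian_dirDeriv (y : ι → ℝ) (F : MvPolynomial ι ℝ) :
    polyLaplacian (dirDeriv y F) = dirDeriv y (polyLaplacian F) := by
  simp only [polyLaplacian, dirDeriv_apply, map_sum, pderiv_C_mul]
  exact Finset.sum_congr rfl fun i _ => Finset.sum_congr rfl fun j _ => by
    rw [pderiv_comm i j F, pderiv_comm i j]

theorem dirDeriv_isHomogeneous (y : ι → ℝ) {F : MvPolynomial ι ℝ} {k : ℕ}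
    (hF : F.IsHomogeneous k) : (dirDeriv y F).IsHomogeneous (k - 1) := by
  rw [dirDeriv_apply]
  refine IsHomogeneous.sum _ _ _ fun i _ => ?_
  simpa using (isHomogeneous_C ι (y i)).mul hF.pderiv

theorem eval_dirDeriv_self (y : ι → ℝ) {F : MvPolynomial ι ℝ} {k : ℕ} (hF : F.IsHomogeneous k) :
    eval y (dirDeriv y F) = k * eval y F := by
  have := congrArg (eval y) hF.sum_X_mul_pderiv
  rw [map_sum, map_nsmul, nsmul_eq_mul] at this
  rw [dirDeriv_apply, map_sum, ← this]
  simp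

theorem linForm_isHomogeneous (y : ι → ℝ) : (linForm y).IsHomogeneous 1 :=
  IsHomogeneous.sum _ _ _ fun i _ => by
    simpa using (isHomogeneous_C ι (y i)).mul (isHomogeneous_X ℝ i)

theorem sqNormPoly_isHomogeneous : (sqNormPoly ι).IsHomogeneous 2 :=
  IsHomogeneous.sum _ _ _ fun i _ => (isHomogeneous_X ℝ i).mul (isHomogeneous_X ℝ i)

theorem smul_isHomogeneous {ι : Type*} {F : MvPolynomial ι ℝ} {k : ℕ} (hF : F.IsHomogeneous k)
    (c : ℝ) : (c • F).IsHomogeneous k := by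
  rw [MvPolynomial.smul_eq_C_mul]
  simpa using (isHomogeneous_C ι c).mul hF

theorem gegenbauer_isHomogeneous (lam : ℝ) (y : ι → ℝ) (k : ℕ) :
    (gegenbauer lam (linForm y) (sqNormPoly ι) k).IsHomogeneous k := by
  induction k using Nat.twoStepInduction with
  | zero => exact isHomogeneous_one ι ℝ
  | one => exact smul_isHomogeneous (linForm_isHomogeneous y) _
  | more n h0 h1 =>
    refine smul_isHomogeneous (IsHomogeneous.sub (smul_isHomogeneous ?_ _)
      (smul_isHomogeneous ?_ _)) _
    · rw [show n + 2 = 1 + (n + 1) by ring]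
      exact (linForm_isHomogeneous y).mul h1
    · rw [show n + 2 = 2 + n by ring]
      exact sqNormPoly_isHomogeneous.mul h0

theorem dirDeriv_gegenbauer (lam : ℝ) {y : ι → ℝ} (hy : ∑ i, y i ^ 2 = 1) (n : ℕ) :
    dirDeriv y (gegenbauer lam (linForm y) (sqNormPoly ι) (n + 1)) =
      ((n : ℝ) + 2 * lam) • gegenbauer lam (linForm y) (sqNormPoly ι) n := by
  have hs := dirDeriv_linForm hy
  have hρ := dirDeriv_sqNormPoly (ι := ι) y
  set s := linForm y
  set ρ := sqNormPoly ι
  have key : ∀ m : ℕ, ((m : ℝ) + 2) • gegenbauer lam s ρ (m + 2) =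
      (2 * (m + 1 + lam)) • (s * gegenbauer lam s ρ (m + 1)) -
      (m + 2 * lam) • (ρ * gegenbauer lam s ρ m) := by
    intro m
    rw [gegenbauer, smul_smul, mul_inv_cancel₀ (by positivity), one_smul]
  induction n using Nat.twoStepInduction with
  | zero => simp [gegenbauer, hs]
  | one =>
    have h2 := congrArg (dirDeriv y) (key 0)
    rw [Derivation.map_smul] at h2
    have h3 : ((0 : ℕ) : ℝ) + 2 ≠ 0 := by norm_num
    apply smul_right_injective _ h3
    refine h2.trans ?_
    simp only [gegenbauer, Derivation.map_smul, Derivation.map_sub, Derivation.leibniz, hs, hρ,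
      smul_eq_mul, Derivation.map_one_eq_zero]
    simp only [MvPolynomial.smul_eq_C_mul, map_add, map_mul, map_ofNat, map_one, Nat.cast_one,
      Nat.cast_zero, map_zero]
    ring
  | more n h0 h1 =>
    have h2 := congrArg (dirDeriv y) (key (n + 1))
    have h4 := key n
    simp only [Derivation.map_smul, Derivation.map_sub, Derivation.leibniz, hs, hρ, smul_eq_mul, h0,
    h1] at h2
    have h3 : ((n + 1 : ℕ) : ℝ) + 2 ≠ 0 := by positivity
    apply smul_right_injective _ h3
    dsimp only
    rw [h2]
    simp only [MvPolynomial.smul_eq_C_mul, map_add, map_mul, map_ofNat, map_one, Nat.cast_add,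
      Nat.cast_one, Nat.cast_ofNat, map_natCast] at h4 ⊢
    linear_combination (-(2 * C lam + n + 1)) * h4

theorem polyLaplacian_gegenbauer {lam : ℝ} {y : ι → ℝ} (hy : ∑ i, y i ^ 2 = 1)
    (hd : (Fintype.card ι : ℝ) = 2 * lam + 2) (n : ℕ) :
    polyLaplacian (gegenbauer lam (linForm y) (sqNormPoly ι) n) = 0 := by
  induction n using Nat.twoStepInduction with
  | zero => simp [gegenbauer, polyLaplacian]
  | one => simp [gegenbauer, polyLaplacian, pderiv_linForm]
  | more n h0 h1 =>
    have h2 := dirDeriv_gegenbauer lam hy n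
    have h3 := polyLaplacian_sqNormPoly_mul (gegenbauer_isHomogeneous lam y n)
    rw [gegenbauer, sub_eq_add_neg, ← neg_smul]
    rw [polyLaplacian_smul, polyLaplacian_add, polyLaplacian_smul, polyLaplacian_smul,
      polyLaplacian_linForm_mul, h3, h0, h1, h2, hd]
    simp only [MvPolynomial.smul_eq_C_mul, map_add, map_mul, map_ofNat, map_one, map_natCast,
      map_neg]
    ring

/-- The moments against powers of a linear form of a harmonic polynomial, with respect to a
functional satisfying Stein's identity. -/
theorem stein_linForm_pow_mul {L : MvPolynomial ι ℝ →ₗ[ℝ] ℝ}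
    (hL : ∀ i F, L (X i * F) = L (pderiv i F)) {y : ι → ℝ} (hy : ∑ i, y i ^ 2 = 1) (m : ℕ) :
    ∀ (d : ℕ) (Q : MvPolynomial ι ℝ), Q.IsHomogeneous d → polyLaplacian Q = 0 →
      (m < d → L (linForm y ^ m * Q) = 0) ∧
      (m = d → L (linForm y ^ m * Q) = m.factorial * eval y Q * L 1) := by
  have hL' : ∀ F, L (linForm y * F) = L (dirDeriv y F) := by
    intro F
    rw [dirDeriv_apply, linForm, Finset.sum_mul, map_sum, map_sum]
    refine Finset.sum_congr rfl fun i _ => ?_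
    rw [mul_assoc, ← MvPolynomial.smul_eq_C_mul, ← MvPolynomial.smul_eq_C_mul, map_smul, hL,
      map_smul]
  have hstep : ∀ (m : ℕ) (Q : MvPolynomial ι ℝ), L (linForm y ^ (m + 1) * Q) =
      m * L (linForm y ^ (m - 1) * Q) + L (linForm y ^ m * dirDeriv y Q) := by
    intro m Q
    rw [pow_succ', mul_assoc, hL', Derivation.leibniz, Derivation.leibniz_pow, dirDeriv_linForm hy,
      map_add, add_comm]
    congr 1
    rw [← smul_eq_mul (a := (m : ℝ)), ← map_smul, MvPolynomial.smul_eq_C_mul]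
    simp only [smul_eq_mul, nsmul_eq_mul, map_natCast]
    congr 1
    ring
  induction m using Nat.strong_induction_on with
  | _ m ih =>
    intro d Q hQ hΔ
    rcases m with _ | m
    · simp only [pow_zero, one_mul]
      constructor
      · intro hd
        have h1 := congrArg L hQ.sum_X_mul_pderiv
        rw [map_sum, map_nsmul] at h1
        simp only [hL] at h1
        rw [← map_sum] at h1
        have h2 : ∑ i, pderiv i (pderiv i Q) = 0 := hΔ
        rw [h2, map_zero] at h1
        have h3 := (smul_eq_zero.1 h1.symm).resolve_left hd.ne'
        exact h3
      · rintro rfl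
        obtain ⟨c, rfl⟩ : ∃ c, Q = C c := ⟨_, (totalDegree_eq_zero_iff_eq_C.1
          ((totalDegree_zero_iff_isHomogeneous _).2 hQ))⟩
        rw [← mul_one (C c), ← MvPolynomial.smul_eq_C_mul, map_smul]
        simp
    · have hm := ih m (Nat.lt_succ_self m) (d - 1) (dirDeriv y Q) (dirDeriv_isHomogeneous y hQ)
        (by rw [polyLaplacian_dirDeriv, hΔ, map_zero])
      have hz : m + 1 ≤ d → (m : ℝ) * L (linForm y ^ (m - 1) * Q) = 0 := by
        intro hd
        rcases Nat.eq_zero_or_pos m with rfl | hm0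
        · simp
        · rw [(ih (m - 1) (by omega) d Q hQ hΔ).1 (by omega), mul_zero]
      constructor
      · intro hd
        rw [hstep, hz hd.le, hm.1 (by omega), add_zero]
      · intro hd
        rw [hstep, hz hd.le, hm.2 (by omega), zero_add, eval_dirDeriv_self y hQ, ← hd,
          Nat.factorial_succ]
        push_cast
        ring

theorem eval_gegenbauer (lam : ℝ) (x y : ι → ℝ) (k : ℕ) :
    eval x (gegenbauer lam (linForm y) (sqNormPoly ι) k) =
      gegenbauer lam (∑ i, y i * x i) (∑ i, x i ^ 2) k := by
  have := AlgHom.map_gegenbauer (aeval x : MvPolynomial ι ℝ →ₐ[ℝ] ℝ) lam (linForm y)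
    (sqNormPoly ι) k
  simp only [MvPolynomial.aeval_eq_eval] at this
  rw [this]
  simp [linForm, sqNormPoly, pow_two]

end Polynomial

/-! ### The Gaussian functional on polynomials -/

theorem integrable_pow_mul_exp_neg_sq_div_two (k : ℕ) :
    Integrable fun x : ℝ => x ^ k * Real.exp (-(x ^ 2 / 2)) := by
  have h := integrable_rpow_mul_exp_neg_mul_sq (b := 1 / 2) (by norm_num) (s := k)
    (by linarith [(Nat.cast_nonneg k : (0 : ℝ) ≤ k)])
  refine h.congr (ae_of_all _ fun x => ?_)
  simp only [Real.rpow_natCast]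
  congr 2
  ring

/-- The (unnormalized) moments of the one-dimensional Gaussian measure. -/
def gaussMoment (k : ℕ) : ℝ := ∫ x : ℝ, x ^ k * Real.exp (-(x ^ 2 / 2))

theorem gaussMoment_succ (k : ℕ) : gaussMoment (k + 1) = k * gaussMoment (k - 1) := by
  have h := integral_mul_deriv_eq_deriv_mul_of_integrable (u := fun x : ℝ => x ^ k)
    (v := fun x : ℝ => -Real.exp (-(x ^ 2 / 2))) (u' := fun x => k * x ^ (k - 1))
    (v' := fun x => x * Real.exp (-(x ^ 2 / 2)))
    (fun x _ => hasDerivAt_pow k x) (fun x _ => ?_) ?_ ?_ ?_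
  · simp only [gaussMoment]
    rw [← integral_const_mul]
    convert! h using 1
    · congr 1 with x; ring
    · rw [← integral_neg]; congr 1 with x; ring
  · have h1 : HasDerivAt (fun x : ℝ => -(x ^ 2 / 2)) (-x) x := by
      convert! ((hasDerivAt_pow 2 x).div_const 2).neg using 1
      simp
    convert! h1.exp.neg using 1
    ring
  · refine (integrable_pow_mul_exp_neg_sq_div_two (k + 1)).congr (ae_of_all _ fun x => ?_)
    simp only [Pi.mul_apply]; ring
  · refine ((integrable_pow_mul_exp_neg_sq_div_two (k - 1)).const_mul (-(k : ℝ))).congr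
      (ae_of_all _ fun x => ?_)
    simp only [Pi.mul_apply]; ring
  · refine (integrable_pow_mul_exp_neg_sq_div_two k).neg.congr (ae_of_all _ fun x => ?_)
    simp only [Pi.mul_apply, Pi.neg_apply]; ring

section Gauss

open MvPolynomial

variable {ι : Type*} [Fintype ι]

theorem eval_monomial_mul_exp (s : ι →₀ ℕ) (c : ℝ) (x : ι → ℝ) :
    eval x (monomial s c) * Real.exp (-((∑ i, x i ^ 2) / 2)) =
      c * ∏ i, (x i ^ s i * Real.exp (-(x i ^ 2 / 2))) := by
  rw [eval_monomial, Finsupp.prod_fintype _ _ (fun i => pow_zero _), Finset.prod_mul_distrib,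
    ← Real.exp_sum, Finset.sum_neg_distrib, Finset.sum_div, mul_assoc]

theorem integrable_eval_mul_exp (P : MvPolynomial ι ℝ) :
    Integrable fun x : ι → ℝ => eval x P * Real.exp (-((∑ i, x i ^ 2) / 2)) := by
  induction P using MvPolynomial.induction_on' with
  | monomial s c =>
    simp only [eval_monomial_mul_exp]
    exact (Integrable.fintype_prod
      (f := fun i (t : ℝ) => t ^ s i * Real.exp (-(t ^ 2 / 2)))
      fun i => integrable_pow_mul_exp_neg_sq_div_two (s i)).const_mul c
  | add p q hp hq =>
    simp only [map_add, add_mul]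
    exact hp.add hq

/-- Integration of polynomials against the Gaussian weight. -/
def gaussFunctional (ι : Type*) [Fintype ι] : MvPolynomial ι ℝ →ₗ[ℝ] ℝ where
  toFun P := ∫ x : ι → ℝ, eval x P * Real.exp (-((∑ i, x i ^ 2) / 2))
  map_add' P Q := by
    simp only [map_add, add_mul]
    exact integral_add (integrable_eval_mul_exp P) (integrable_eval_mul_exp Q)
  map_smul' c P := by
    simp only [smul_eval, mul_assoc, RingHom.id_apply, smul_eq_mul]
    exact integral_const_mul _ _

theorem gaussFunctional_monomial (s : ι →₀ ℕ) (c : ℝ) :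
    gaussFunctional ι (monomial s c) = c * ∏ i, gaussMoment (s i) := by
  change ∫ x : ι → ℝ, eval x (monomial s c) * Real.exp (-((∑ i, x i ^ 2) / 2)) = _
  simp only [eval_monomial_mul_exp]
  rw [integral_const_mul]
  congr 1
  exact integral_fintype_prod_volume_eq_prod
    (fun i (t : ℝ) => t ^ s i * Real.exp (-(t ^ 2 / 2)))

theorem gaussFunctional_X_mul (i : ι) (F : MvPolynomial ι ℝ) :
    gaussFunctional ι (X i * F) = gaussFunctional ι (pderiv i F) := by
  classical
  induction F using MvPolynomial.induction_on' with
  | monomial s c =>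
    have h1 : (X i * monomial s c : MvPolynomial ι ℝ) = monomial (s + Finsupp.single i 1) c := by
      rw [monomial_add_single, pow_one, mul_comm]
    rw [h1, pderiv_monomial, gaussFunctional_monomial, gaussFunctional_monomial,
      ← Finset.mul_prod_erase Finset.univ
        (fun j => gaussMoment ((s + Finsupp.single i 1 : ι →₀ ℕ) j)) (Finset.mem_univ i),
      ← Finset.mul_prod_erase Finset.univ
        (fun j => gaussMoment ((s - Finsupp.single i 1 : ι →₀ ℕ) j)) (Finset.mem_univ i)]
    simp only [Finsupp.add_apply, Finsupp.tsub_apply, Finsupp.single_eq_same, gaussMoment_succ]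
    have h2 : ∀ j ∈ Finset.univ.erase i, Finsupp.single i 1 j = 0 := fun j hj =>
      Finsupp.single_eq_of_ne (Finset.ne_of_mem_erase hj)
    have h3 : ∀ j ∈ Finset.univ.erase i, gaussMoment (s j + Finsupp.single i 1 j) =
        gaussMoment (s j - Finsupp.single i 1 j) := fun j hj => by
      rw [h2 j hj, add_zero, tsub_zero]
    rw [Finset.prod_congr rfl h3]
    ring
  | add p q hp hq => rw [mul_add, map_add, map_add, map_add, hp, hq]

theorem gaussFunctional_one_pos : 0 < gaussFunctional ι 1 := by
  have h : gaussMoment 0 = √(2 * π) := by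
    have := integral_gaussian (1 / 2)
    simp only [gaussMoment, pow_zero, one_mul]
    rw [show 2 * π = π / (1 / 2) by ring, ← this]
    congr 1 with x
    congr 1
    ring
  have h1 : (1 : MvPolynomial ι ℝ) = monomial 0 1 := rfl
  rw [h1, gaussFunctional_monomial]
  simp only [Finsupp.coe_zero, Pi.zero_apply, h, one_mul]
  have := Real.pi_pos
  positivity

theorem MvPolynomial.IsHomogeneous.eval_smul {F : MvPolynomial ι ℝ} {k : ℕ}
    (hF : F.IsHomogeneous k) (r : ℝ) (x : ι → ℝ) : eval (r • x) F = r ^ k * eval x F := by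
  rw [eval_eq', eval_eq', Finset.mul_sum]
  refine Finset.sum_congr rfl fun s hs => ?_
  have h := hF (mem_support_iff.1 hs)
  have h2 : ∑ i, s i = k := by
    rw [← h, Finsupp.weight_apply, Finsupp.sum_fintype _ _ (by simp)]
    simp
  simp only [Pi.smul_apply, smul_eq_mul, mul_pow, Finset.prod_mul_distrib, Finset.prod_pow_eq_pow_sum,
    h2]
  ring

end Gauss

/-! ### Integration of homogeneous polynomials over the sphere -/

/-- The radial part of the Gaussian integral of a homogeneous polynomial of degree `k`. -/
def radialMoment (N k : ℕ) : ℝ :=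
  ∫ r : Set.Ioi (0 : ℝ), (r : ℝ) ^ k * Real.exp (-((r : ℝ) ^ 2 / 2)) ∂(Measure.volumeIoiPow N)

theorem radialMoment_eq (N k : ℕ) :
    radialMoment N k = (1 / 2) ^ (-((N + k : ℕ) + 1 : ℝ) / 2) * (1 / 2) *
      Real.Gamma (((N + k : ℕ) + 1) / 2) := by
  rw [← integral_rpow_mul_exp_neg_mul_rpow (by norm_num)
    (by linarith [(Nat.cast_nonneg (N + k) : (0 : ℝ) ≤ (N + k : ℕ))]) (by norm_num), radialMoment,
    Measure.volumeIoiPow, integral_withDensity_eq_integral_toReal_smul (by fun_prop) (by simp),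
    integral_subtype_comap measurableSet_Ioi fun r : ℝ =>
      (ENNReal.ofReal (r ^ N)).toReal • (r ^ k * Real.exp (-(r ^ 2 / 2)))]
  refine setIntegral_congr_fun measurableSet_Ioi fun r hr => ?_
  have hr' : (0 : ℝ) < r := hr
  simp only [Real.rpow_natCast, smul_eq_mul, Real.rpow_ofNat]
  rw [ENNReal.toReal_ofReal (by positivity), ← mul_assoc, pow_add]
  congr 2
  ring

theorem radialMoment_pos (N k : ℕ) : 0 < radialMoment N k := by
  rw [radialMoment_eq]
  have : 0 < Real.Gamma (((N + k : ℕ) + 1) / 2) := Real.Gamma_pos_of_pos (by positivity)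
  positivity

theorem radialMoment_add_two (N k : ℕ) :
    radialMoment N (k + 2) = (N + k + 1) * radialMoment N k := by
  rw [radialMoment_eq, radialMoment_eq]
  have h1 : (((N + (k + 2) : ℕ) : ℝ) + 1) / 2 = ((N + k : ℕ) + 1) / 2 + 1 := by push_cast; ring
  have h2 : (-((N + (k + 2) : ℕ) + 1 : ℝ) / 2) = -((N + k : ℕ) + 1) / 2 + (-1) := by
    push_cast; ring
  rw [h1, h2, Real.Gamma_add_one (by positivity), Real.rpow_add (by norm_num), Real.rpow_neg_one]
  push_cast
  ring

theorem gaussFunctional_eq_radialMoment_mul {N k : ℕ} {P : MvPolynomial (Fin (N + 1)) ℝ}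
    (hP : P.IsHomogeneous k) :
    gaussFunctional (Fin (N + 1)) P =
      radialMoment N k * ∫ x : Sph N, MvPolynomial.eval
        (fun i => (x : EuclideanSpace ℝ (Fin (N + 1))) i) P ∂(sphMeasure N) := by
  set g : EuclideanSpace ℝ (Fin (N + 1)) → ℝ := fun x =>
    MvPolynomial.eval (fun i => x i) P * Real.exp (-(‖x‖ ^ 2 / 2)) with hg
  have h1 : gaussFunctional (Fin (N + 1)) P = ∫ x, g x := by
    rw [← (PiLp.volume_preserving_toLp (Fin (N + 1))).integral_comp
      (MeasurableEquiv.toLp 2 (Fin (N + 1) → ℝ)).measurableEmbedding]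
    simp only [hg, EuclideanSpace.real_norm_sq_eq]
    rfl
  have h2 : ∫ x, g x = ∫ x : ({0}ᶜ : Set (EuclideanSpace ℝ (Fin (N + 1)))), g x
      ∂(volume.comap Subtype.val) := by
    rw [integral_subtype_comap (measurableSet_singleton _).compl, restrict_compl_singleton]
  have h3 := (Measure.measurePreserving_homeomorphUnitSphereProd
    (volume : Measure (EuclideanSpace ℝ (Fin (N + 1))))).integral_comp
    (Homeomorph.measurableEmbedding _) fun p => g ((p.2 : ℝ) • (p.1 : EuclideanSpace ℝ (Fin (N + 1))))
  have h4 : ∀ x : ({0}ᶜ : Set (EuclideanSpace ℝ (Fin (N + 1)))),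
      (((homeomorphUnitSphereProd (EuclideanSpace ℝ (Fin (N + 1))) x).2 : ℝ) •
      ((homeomorphUnitSphereProd (EuclideanSpace ℝ (Fin (N + 1))) x).1 :
        EuclideanSpace ℝ (Fin (N + 1)))) = x := by
    intro x
    have hx : ‖(x : EuclideanSpace ℝ (Fin (N + 1)))‖ ≠ 0 := norm_ne_zero_iff.2 x.2
    simp [hx]
  simp only [h4] at h3
  rw [h1, h2, h3, finrank_euclideanSpace, Fintype.card_fin, Nat.add_sub_cancel]
  have h5 : ∀ p : Sph N × Set.Ioi (0 : ℝ),
      g ((p.2 : ℝ) • (p.1 : EuclideanSpace ℝ (Fin (N + 1)))) =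
      MvPolynomial.eval (fun i => (p.1 : EuclideanSpace ℝ (Fin (N + 1))) i) P *
        ((p.2 : ℝ) ^ k * Real.exp (-((p.2 : ℝ) ^ 2 / 2))) := by
    intro p
    have hx : ‖(p.1 : EuclideanSpace ℝ (Fin (N + 1)))‖ = 1 := by simp
    have hr : |(p.2 : ℝ)| = p.2 := abs_of_pos p.2.2
    have := hP.eval_smul (p.2 : ℝ) fun i => (p.1 : EuclideanSpace ℝ (Fin (N + 1))) i
    simp only [hg, norm_smul, hx, mul_one, Real.norm_eq_abs, hr]
    rw [mul_comm _ ((p.2 : ℝ) ^ k * _), mul_right_comm, ← this]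
    rfl
  simp only [h5]
  rw [mul_comm, radialMoment, sphMeasure]
  exact integral_prod_mul (fun x : Sph N => MvPolynomial.eval
    (fun i => (x : EuclideanSpace ℝ (Fin (N + 1))) i) P)
    (fun r : Set.Ioi (0 : ℝ) => (r : ℝ) ^ k * Real.exp (-((r : ℝ) ^ 2 / 2)))

/-! ### The reproducing property of zonal harmonics and the addition formula -/

theorem map_pow_mul_gegenbauer {R : Type*} [CommRing R] [Algebra ℝ R] (M : R →ₗ[ℝ] ℝ) (s : R)
    {d : ℕ} (h0 : ∀ m < d, M (s ^ m) = 0) (lam : ℝ) (k : ℕ) :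
    ∀ m, (m + k < d → M (s ^ m * gegenbauer lam s 1 k) = 0) ∧
      (m + k = d → M (s ^ m * gegenbauer lam s 1 k) =
        2 ^ k * risingCoeff lam k * M (s ^ d)) := by
  induction k using Nat.twoStepInduction with
  | zero =>
    intro m
    simp only [gegenbauer, mul_one, risingCoeff, pow_zero, one_mul, add_zero]
    exact ⟨h0 m, fun h => by rw [h]⟩
  | one =>
    intro m
    have : M (s ^ m * gegenbauer lam s 1 1) = 2 * lam * M (s ^ (m + 1)) := by
      rw [gegenbauer, mul_smul_comm, map_smul, ← pow_succ, smul_eq_mul]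
    rw [this]
    refine ⟨fun h => by rw [h0 _ h, mul_zero], fun h => ?_⟩
    rw [h]
    simp [risingCoeff]
  | more k ih1 ih2 =>
    intro m
    have : M (s ^ m * gegenbauer lam s 1 (k + 2)) = ((k : ℝ) + 2)⁻¹ * (2 * (k + 1 + lam) *
        M (s ^ (m + 1) * gegenbauer lam s 1 (k + 1)) -
        (k + 2 * lam) * M (s ^ m * gegenbauer lam s 1 k)) := by
      rw [gegenbauer, mul_smul_comm, map_smul, mul_sub, map_sub, mul_smul_comm, mul_smul_comm,
        map_smul, map_smul, one_mul, ← mul_assoc, ← pow_succ]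
      rfl
    rw [this]
    constructor
    · intro h
      rw [(ih1 m).1 (by omega), (ih2 (m + 1)).1 (by omega)]
      simp
    · intro h
      have h2 : (k : ℝ) + 2 ≠ 0 := by positivity
      have h3 := risingCoeff_mul_succ lam (k + 1)
      push_cast at h3
      have h4 : risingCoeff lam (k + 2) = risingCoeff lam (k + 1) * (lam + (k + 1)) / (k + 2) := by
        rw [eq_div_iff h2, ← h3]
        ring
      rw [(ih1 m).1 (by omega), (ih2 (m + 1)).2 (by omega), h4]
      field_simp
      ring

instance isFiniteMeasure_sphMeasure (N : ℕ) : IsFiniteMeasure (sphMeasure N) := by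
  unfold sphMeasure; infer_instance

/-- The coordinates of a point of the sphere. -/
def Sph.coords {N : ℕ} (x : Sph N) (i : Fin (N + 1)) : ℝ := (x : EuclideanSpace ℝ (Fin (N + 1))) i

theorem continuous_eval_coords {N : ℕ} (P : MvPolynomial (Fin (N + 1)) ℝ) :
    Continuous fun x : Sph N => MvPolynomial.eval x.coords P :=
  (MvPolynomial.continuous_eval P).comp (by unfold Sph.coords; fun_prop)

theorem Sph.integrable_of_continuous {N : ℕ} {g : Sph N → ℝ} (hg : Continuous g) :
    Integrable g (sphMeasure N) :=
  hg.integrable_of_hasCompactSupport (HasCompactSupport.of_compactSpace g)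

theorem Sph.sum_coords_sq {N : ℕ} (x : Sph N) : ∑ i, x.coords i ^ 2 = 1 := by
  have := EuclideanSpace.real_norm_sq_eq (x : EuclideanSpace ℝ (Fin (N + 1)))
  rw [norm_eq_of_mem_sphere, one_pow] at this
  exact this.symm

theorem Sph.sum_coords_mul {N : ℕ} (x y : Sph N) : ∑ i, y.coords i * x.coords i =
    ⟪(x : EuclideanSpace ℝ (Fin (N + 1))), (y : EuclideanSpace ℝ (Fin (N + 1)))⟫ := by
  simp [PiLp.inner_apply, Sph.coords]

/-- Integration of `Q * P` over the sphere, as a linear functional of `P`. -/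
def sphFunctional {N : ℕ} (Q : MvPolynomial (Fin (N + 1)) ℝ) :
    MvPolynomial (Fin (N + 1)) ℝ →ₗ[ℝ] ℝ where
  toFun P := ∫ x : Sph N, MvPolynomial.eval x.coords (P * Q) ∂(sphMeasure N)
  map_add' P P' := by
    simp only [add_mul, map_add]
    exact integral_add (Sph.integrable_of_continuous (continuous_eval_coords _))
      (Sph.integrable_of_continuous (continuous_eval_coords _))
  map_smul' c P := by
    simp only [smul_mul_assoc, MvPolynomial.smul_eval, RingHom.id_apply, smul_eq_mul]
    exact integral_const_mul _ _

theorem two_pow_mul_risingCoeff_div_radialMoment {N : ℕ} {lam : ℝ} (hl : 0 < lam)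
    (hN : (N : ℝ) = 2 * lam + 1) (d : ℕ) :
    (d + lam) / lam * (2 ^ d * risingCoeff lam d) * (d.factorial / radialMoment N (d + d)) =
      1 / radialMoment N 0 := by
  induction d with
  | zero => simp [risingCoeff, hl.ne']
  | succ d ih =>
    rw [← ih, show d + 1 + (d + 1) = d + d + 2 by ring, radialMoment_add_two, risingCoeff,
      Nat.factorial_succ, hN]
    have h1 := radialMoment_pos N (d + d)
    have h2 : (d : ℝ) + 1 + lam ≠ 0 := by positivity
    have h3 : 2 * lam + 1 + ((d : ℝ) + d) + 1 ≠ 0 := by positivity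
    push_cast
    field_simp
    ring

/-- Zonal spherical harmonics, as functions of the cosine of the distance to the pole. -/
def zonal (lam : ℝ) (k : ℕ) (t : ℝ) : ℝ := (k + lam) / lam * gegenbauer lam t 1 k

theorem integral_zonal_mul {N : ℕ} {lam : ℝ} (hl : 0 < lam) (hN : (N : ℝ) = 2 * lam + 1) {d : ℕ}
    {Q : MvPolynomial (Fin (N + 1)) ℝ} (hQ : Q.IsHomogeneous d) (hQ' : polyLaplacian Q = 0)
    (y : Sph N) :
    ∫ x : Sph N, zonal lam d
      ⟪(x : EuclideanSpace ℝ (Fin (N + 1))), (y : EuclideanSpace ℝ (Fin (N + 1)))⟫ *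
        MvPolynomial.eval x.coords Q ∂(sphMeasure N) =
      gaussFunctional (Fin (N + 1)) 1 / radialMoment N 0 * MvPolynomial.eval y.coords Q := by
  have hr := fun m => (radialMoment_pos N (m + d)).ne'
  have hM : ∀ m, gaussFunctional (Fin (N + 1)) (linForm y.coords ^ m * Q) =
      radialMoment N (m + d) * sphFunctional Q (linForm y.coords ^ m) := fun m => by
    have h := ((linForm_isHomogeneous y.coords).pow m).mul hQ
    rw [one_mul] at h
    exact gaussFunctional_eq_radialMoment_mul h
  have hs := fun m => stein_linForm_pow_mul (L := gaussFunctional (Fin (N + 1)))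
    gaussFunctional_X_mul y.sum_coords_sq m d Q hQ hQ'
  have h0 : ∀ m < d, sphFunctional Q (linForm y.coords ^ m) = 0 := fun m hm => by
    have := (hs m).1 hm
    rw [hM] at this
    exact (mul_eq_zero.1 this).resolve_left (hr m)
  have h1 := ((map_pow_mul_gegenbauer (sphFunctional Q) (linForm y.coords) h0 lam d) 0).2
    (zero_add d)
  have h2 := (hs d).2 rfl
  rw [hM] at h2
  have h3 : sphFunctional Q (linForm y.coords ^ d) = d.factorial / radialMoment N (d + d) *
      (gaussFunctional (Fin (N + 1)) 1 * MvPolynomial.eval y.coords Q) := by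
    have := hr d
    field_simp
    linarith
  have h4 : ∀ x : Sph N, zonal lam d
      ⟪(x : EuclideanSpace ℝ (Fin (N + 1))), (y : EuclideanSpace ℝ (Fin (N + 1)))⟫ *
        MvPolynomial.eval x.coords Q = (d + lam) / lam * MvPolynomial.eval x.coords
        (linForm y.coords ^ 0 * gegenbauer lam (linForm y.coords) 1 d * Q) := fun x => by
    have := AlgHom.map_gegenbauer (MvPolynomial.aeval x.coords) lam (linForm y.coords) 1 d
    rw [map_one] at this
    rw [pow_zero, one_mul, map_mul, ← MvPolynomial.coe_aeval_eq_eval, RingHom.coe_coe, this, zonal,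
      ← Sph.sum_coords_mul, mul_assoc]
    simp [linForm]
  simp only [h4]
  rw [integral_const_mul]
  change (d + lam) / lam * sphFunctional Q _ = _
  rw [h1, h3]
  have := two_pow_mul_risingCoeff_div_radialMoment hl hN d
  linear_combination (gaussFunctional (Fin (N + 1)) 1 * MvPolynomial.eval y.coords Q) * this

theorem isSphericalHarmonic_zonal {N : ℕ} {lam : ℝ} (hN : (N : ℝ) = 2 * lam + 1) (k : ℕ)
    (y : Sph N) : IsSphericalHarmonic N k fun x => zonal lam k
      ⟪(x : EuclideanSpace ℝ (Fin (N + 1))), (y : EuclideanSpace ℝ (Fin (N + 1)))⟫ := by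
  refine ⟨((k + lam) / lam) • gegenbauer lam (linForm y.coords) (sqNormPoly (Fin (N + 1))) k,
    smul_isHomogeneous (gegenbauer_isHomogeneous lam y.coords k) _, ?_, fun x => ?_⟩
  · have h := polyLaplacian_gegenbauer (lam := lam) y.sum_coords_sq
      (by rw [Fintype.card_fin]; push_cast; linarith) k
    change polyLaplacian _ = 0
    rw [polyLaplacian_smul, h, smul_zero]
  · change _ = MvPolynomial.eval x.coords _
    rw [MvPolynomial.smul_eval, eval_gegenbauer, x.sum_coords_sq, Sph.sum_coords_mul]
    rfl

theorem IsSphericalHarmonic.continuous {N k : ℕ} {g : Sph N → ℝ} (hg : IsSphericalHarmonic N k g) :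
    Continuous g := by
  obtain ⟨P, -, -, h⟩ := hg
  exact (continuous_eval_coords P).congr fun x => (h x).symm

/-- The addition formula for spherical harmonics. -/
theorem IsFourierLaplaceBasis.zonal_eq_sum {N : ℕ} {a : ℕ → ℕ}
    {Y : (k : ℕ) → Fin (a k) → Sph N → ℝ} (hY : IsFourierLaplaceBasis N a Y) {lam : ℝ}
    (hl : 0 < lam) (hN : (N : ℝ) = 2 * lam + 1) (k : ℕ) (x y : Sph N) :
    zonal lam k
      ⟪(x : EuclideanSpace ℝ (Fin (N + 1))), (y : EuclideanSpace ℝ (Fin (N + 1)))⟫ =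
      gaussFunctional (Fin (N + 1)) 1 / radialMoment N 0 * ∑ j, Y k j x * Y k j y := by
  obtain ⟨c, hc⟩ := (Submodule.mem_span_range_iff_exists_fun ℝ).1
    (hY.spanning k _ (isSphericalHarmonic_zonal hN k y))
  have hz : ∀ x : Sph N, zonal lam k
      ⟪(x : EuclideanSpace ℝ (Fin (N + 1))), (y : EuclideanSpace ℝ (Fin (N + 1)))⟫ =
      ∑ j, c j * Y k j x := fun x => by
    rw [← congrFun hc x]
    simp
  have hcoef : ∀ i, c i = gaussFunctional (Fin (N + 1)) 1 / radialMoment N 0 * Y k i y := by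
    intro i
    obtain ⟨P, hP, hP', h⟩ := hY.harmonic k i
    have h1 := integral_zonal_mul hl hN hP hP' y
    have h2 : ∀ x : Sph N, MvPolynomial.eval x.coords P = Y k i x := fun x => (h x).symm
    simp only [h2, hz, Finset.sum_mul, mul_assoc] at h1
    have h3 : ∀ j, Integrable (fun x => c j * (Y k j x * Y k i x)) (sphMeasure N) := fun j =>
      (Sph.integrable_of_continuous
        ((hY.harmonic k j).continuous.mul (hY.harmonic k i).continuous)).const_mul (c j)
    rw [integral_finsetSum _ fun j _ => h3 j] at h1
    simp only [integral_const_mul, hY.orthonormal] at h1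
    simpa using h1
  rw [hz, Finset.mul_sum]
  exact Finset.sum_congr rfl fun j _ => by rw [hcoef]; ring

theorem exists_cesaroKernel_eq {N : ℕ} {a : ℕ → ℕ}
    {Y : (k : ℕ) → Fin (a k) → Sph N → ℝ} (hY : IsFourierLaplaceBasis N a Y) {lam : ℝ}
    (hl : 0 < lam) (hN : (N : ℝ) = 2 * lam + 1) :
    ∃ v : ℝ, 0 < v ∧ ∀ (α : ℝ) (n : ℕ) (x y : Sph N), cesaroKernel Y α n x y =
      v * zonalKernel lam α n
      ⟪(x : EuclideanSpace ℝ (Fin (N + 1))), (y : EuclideanSpace ℝ (Fin (N + 1)))⟫ := by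
  have hv : 0 < gaussFunctional (Fin (N + 1)) 1 / radialMoment N 0 :=
    div_pos gaussFunctional_one_pos (radialMoment_pos N 0)
  refine ⟨_, inv_pos.2 hv, fun α n x y => ?_⟩
  rw [cesaroKernel, zonalKernel, mul_left_comm]
  congr 1
  rw [Finset.mul_sum]
  refine Finset.sum_congr rfl fun k _ => ?_
  have := hY.zonal_eq_sum hl hN k x y
  rw [zonal] at this
  rw [this, mul_left_comm _ (cesaroA α _), inv_mul_cancel_left₀ hv.ne']

/-- The Cesàro means are integral operators. -/
theorem IsFourierLaplaceBasis.cesaroMean_eq {N : ℕ} {a : ℕ → ℕ}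
    {Y : (k : ℕ) → Fin (a k) → Sph N → ℝ} (hY : IsFourierLaplaceBasis N a Y) (α : ℝ)
    {f : Sph N → ℝ} (hf : Integrable f (sphMeasure N)) (n : ℕ) (x : Sph N) :
    cesaroMean Y α f n x = ∫ y, f y * cesaroKernel Y α n x y ∂(sphMeasure N) := by
  have hYint : ∀ k j, Integrable (fun y => f y * Y k j y) (sphMeasure N) := fun k j => by
    obtain ⟨C, hC⟩ := isCompact_univ.exists_bound_of_continuousOn
      (hY.harmonic k j).continuous.continuousOn
    exact hf.mul_bdd (c := C) (hY.harmonic k j).continuous.aestronglyMeasurable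
      (ae_of_all _ fun y => hC y (Set.mem_univ y))
  have h : ∀ y, f y * cesaroKernel Y α n x y = (cesaroA α n)⁻¹ *
      ∑ k ∈ Finset.range (n + 1), cesaroA α (n - k) * ∑ j, f y * Y k j y * Y k j x := fun y => by
    rw [cesaroKernel, mul_left_comm, Finset.mul_sum]
    congr 1
    refine Finset.sum_congr rfl fun k _ => ?_
    rw [mul_left_comm, Finset.mul_sum]
    congr 1
    exact Finset.sum_congr rfl fun j _ => by ring
  simp only [h, cesaroMean, flCoeff]
  rw [integral_const_mul, integral_finsetSum _ fun k _ => (integrable_finsetSum _ fun j _ =>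
    (hYint k j).mul_const _).const_mul _]
  congr 1
  refine Finset.sum_congr rfl fun k _ => ?_
  rw [integral_const_mul, integral_finsetSum _ fun j _ => (hYint k j).mul_const _]
  simp only [integral_mul_const]

/-! ### Dyadic form of the kernel estimates -/

theorem exists_zonalKernel_dyadic_bound {N : ℕ} {lam α : ℝ} (hl : 0 < lam) (hα : lam < α)
    (hN : (N : ℝ) = 2 * lam + 1) :
    ∃ C q₁ q₂ : ℝ, 0 < C ∧ (0 < q₁ ∧ q₁ < 1) ∧ (0 < q₂ ∧ q₂ < 1) ∧
      ∀ n : ℕ, 1 ≤ n → ∀ t : ℝ, -1 ≤ t → t ≤ 1 →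
        (∃ i : ℕ, √(2 - 2 * t) ≤ 2 ^ (i + 1) * (1 / ((n : ℝ) + 1)) ∧
          |zonalKernel lam α n t| * (2 ^ (i + 1) * (1 / ((n : ℝ) + 1))) ^ N ≤ C * q₁ ^ i) ∨
        (∃ i : ℕ, √(2 + 2 * t) ≤ 2 * (1 / 2) ^ i ∧
          |zonalKernel lam α n t| * (2 * (1 / 2) ^ i) ^ N ≤ C * q₂ ^ i) := by
  obtain ⟨C, hC, hb⟩ := exists_zonalKernel_bound hl hα
  set δ := min (α - lam) 1 with hδ
  have hδ0 : 0 < δ := lt_min (by linarith) one_pos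
  have h2l : (1 : ℝ) < 2 ^ lam := Real.one_lt_rpow one_lt_two hl
  refine ⟨2 ^ N * (C + 1), (2 ^ δ)⁻¹, (2 ^ (lam + 1))⁻¹, by positivity,
    ⟨by positivity, inv_lt_one_of_one_lt₀ (Real.one_lt_rpow one_lt_two hδ0)⟩,
    ⟨by positivity, inv_lt_one_of_one_lt₀ (Real.one_lt_rpow one_lt_two (by linarith))⟩,
    fun n hn t ht ht' => ?_⟩
  obtain ⟨hb1, hb2⟩ := hb n hn t ht ht'
  set ρ : ℝ := 1 / ((n : ℝ) + 1) with hρ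
  have hρ0 : 0 < ρ := by positivity
  have hρ1 : ρ ≤ 1 := by
    rw [hρ, div_le_one (by positivity)]
    linarith [(Nat.cast_nonneg n : (0 : ℝ) ≤ n)]
  set z := |zonalKernel lam α n t| with hz
  have hz0 : 0 ≤ z := abs_nonneg _
  set D := √(2 - 2 * t) with hD
  set E := √(2 + 2 * t) with hE
  rcases le_or_gt 0 t with h0 | h0
  · left
    have hE1 : 1 ≤ E ^ lam := Real.one_le_rpow (Real.one_le_sqrt.2 (by linarith)) hl.le
    have hb3 : z * D ^ (2 * lam + 1 + δ) ≤ C * ρ ^ δ := by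
      refine le_trans ?_ hb2
      refine mul_le_mul_of_nonneg_left ?_ hz0
      exact le_mul_of_one_le_right (Real.rpow_nonneg (Real.sqrt_nonneg _) _) hE1
    rcases le_or_gt D (2 * ρ) with h1 | h1
    · refine ⟨0, by simpa using h1, ?_⟩
      rw [← hN, Real.rpow_neg hρ0.le, Real.rpow_natCast] at hb1
      have h2 : z * ρ ^ N ≤ C := by
        have := mul_le_mul_of_nonneg_right hb1 (pow_nonneg hρ0.le N)
        rwa [inv_mul_cancel_right₀ (pow_pos hρ0 N).ne'] at this
      have : 2 ^ N * (z * ρ ^ N) ≤ 2 ^ N * (C + 1) :=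
        mul_le_mul_of_nonneg_left (by linarith) (by positivity)
      simpa [mul_pow, mul_left_comm] using this
    · obtain ⟨i, hi1, hi2⟩ := exists_nat_pow_near (x := D / ρ) (y := 2)
        (by rw [one_le_div hρ0]; linarith) one_lt_two
      rw [le_div_iff₀ hρ0] at hi1
      rw [div_lt_iff₀ hρ0] at hi2
      refine ⟨i, hi2.le, ?_⟩
      have h2 : (2 ^ i * ρ) ^ (2 * lam + 1 + δ) ≤ D ^ (2 * lam + 1 + δ) :=
        Real.rpow_le_rpow (by positivity) hi1 (by positivity)
      have h3 : (2 ^ i * ρ) ^ (2 * lam + 1 + δ) = (2 ^ i * ρ) ^ N * ((2 ^ δ) ^ i * ρ ^ δ) := by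
        rw [Real.rpow_add (by positivity), ← hN, Real.rpow_natCast,
          Real.mul_rpow (by positivity) hρ0.le, ← Real.rpow_natCast 2 i, ← Real.rpow_mul (by simp),
          mul_comm (i : ℝ), Real.rpow_mul (by simp), Real.rpow_natCast (2 ^ δ)]
      rw [h3] at h2
      have h4 : (z * (2 ^ i * ρ) ^ N * (2 ^ δ) ^ i) * ρ ^ δ ≤ C * ρ ^ δ := by
        refine le_trans (le_trans (le_of_eq ?_) (mul_le_mul_of_nonneg_left h2 hz0)) hb3
        ring
      have h5 := le_of_mul_le_mul_right h4 (by positivity)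
      have h6 : z * (2 ^ i * ρ) ^ N ≤ (C + 1) * (2 ^ δ)⁻¹ ^ i := by
        rw [inv_pow, ← div_eq_mul_inv, le_div_iff₀ (by positivity)]
        linarith
      calc z * (2 ^ (i + 1) * ρ) ^ N = 2 ^ N * (z * (2 ^ i * ρ) ^ N) := by
            rw [pow_succ, mul_right_comm, mul_pow _ (2 : ℝ) N]; ring
        _ ≤ 2 ^ N * ((C + 1) * (2 ^ δ)⁻¹ ^ i) := mul_le_mul_of_nonneg_left h6 (by positivity)
        _ = _ := by ring
  · right
    have hD1 : 1 ≤ D ^ (2 * lam + 1 + δ) :=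
      Real.one_le_rpow (Real.one_le_sqrt.2 (by linarith)) (by positivity)
    have hb3 : z * E ^ lam ≤ C := by
      have h1 : ρ ^ δ ≤ 1 := Real.rpow_le_one hρ0.le hρ1 hδ0.le
      refine le_trans (le_trans ?_ hb2) (mul_le_of_le_one_right hC h1)
      refine mul_le_mul_of_nonneg_left ?_ hz0
      exact le_mul_of_one_le_left (Real.rpow_nonneg (Real.sqrt_nonneg _) _) hD1
    have hE2 : E / 2 ≤ 1 := by
      rw [div_le_one two_pos, hE, Real.sqrt_le_left two_pos.le]
      linarith
    obtain ⟨i, hi1, hi2⟩ : ∃ i : ℕ, E ≤ 2 * (1 / 2) ^ i ∧ z ≤ (C + 1) * (2 ^ lam) ^ i := by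
      rcases (Real.sqrt_nonneg _ : 0 ≤ E).eq_or_lt with h1 | h1
      · obtain ⟨i, hi⟩ := pow_unbounded_of_one_lt z h2l
        refine ⟨i, h1.symm.trans_le (by positivity), hi.le.trans ?_⟩
        exact le_mul_of_one_le_left (by positivity) (by linarith)
      · obtain ⟨i, hi1, hi2⟩ := exists_nat_pow_near_of_lt_one (x := E / 2) (y := 1 / 2)
          (by positivity) hE2 (by norm_num) (by norm_num)
        refine ⟨i, by linarith, ?_⟩
        have h2 : ((1 / 2) ^ i) ^ lam ≤ E ^ lam :=
          Real.rpow_le_rpow (by positivity) (by rw [pow_succ] at hi1; linarith) hl.le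
        have h3 : ((1 / 2 : ℝ) ^ i) ^ lam = ((2 ^ lam) ^ i)⁻¹ := by
          rw [one_div, inv_pow, Real.inv_rpow (by positivity), ← Real.rpow_natCast 2 i,
            ← Real.rpow_mul (by simp), mul_comm (i : ℝ), Real.rpow_mul (by simp),
            Real.rpow_natCast]
        rw [h3] at h2
        have h4 := (mul_le_mul_of_nonneg_left h2 hz0).trans hb3
        rw [← div_eq_mul_inv, div_le_iff₀ (by positivity)] at h4
        exact h4.trans (mul_le_mul_of_nonneg_right (by linarith) (by positivity))
    refine ⟨i, hi1, ?_⟩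
    have h5 : ((2 : ℝ) ^ (lam + 1))⁻¹ = (1 / 2) ^ N * 2 ^ lam := by
      have : (2 : ℝ) ^ N = 2 ^ lam * 2 ^ (lam + 1) := by
        rw [← Real.rpow_natCast, ← Real.rpow_add two_pos, hN]
        congr 1; ring
      rw [one_div, inv_pow, this]
      field_simp
    calc z * (2 * (1 / 2) ^ i) ^ N = 2 ^ N * ((1 / 2) ^ N) ^ i * z := by
          rw [mul_pow, ← pow_mul, ← pow_mul, mul_comm i]; ring
      _ ≤ 2 ^ N * ((1 / 2) ^ N) ^ i * ((C + 1) * (2 ^ lam) ^ i) :=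
          mul_le_mul_of_nonneg_left hi2 (by positivity)
      _ = _ := by rw [h5, mul_pow]; ring

/-! ### A maximal inequality -/

theorem mul_measure_le_of_lt_setLIntegral_closedBall {X : Type*} [MetricSpace X]
    [SecondCountableTopology X] [MeasurableSpace X] [OpensMeasurableSpace X] {μ : Measure X}
    {V : ℝ≥0∞} {N : ℕ} (hV : ∀ x r, 0 < r → μ (closedBall x r) ≤ V * ENNReal.ofReal r ^ N)
    {R : ℝ} (hR : 0 < R) (hdist : ∀ x y : X, dist x y ≤ R) {T : X → X} (hT : Isometry T)
    (hTT : Function.Involutive T) (g : X → ℝ≥0∞) (s : ℝ≥0∞) :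
    s * μ {x | ∃ r > 0, s * ENNReal.ofReal r ^ N < ∫⁻ y in closedBall (T x) r, g y ∂μ} ≤
      V * 4 ^ N * ∫⁻ y, g y ∂μ := by
  set A := {z | ∃ r > 0, r ≤ R ∧ s * ENNReal.ofReal r ^ N < ∫⁻ y in closedBall z r, g y ∂μ}
    with hA
  have hmem : ∀ z, (∃ r > 0, s * ENNReal.ofReal r ^ N < ∫⁻ y in closedBall z r, g y ∂μ) →
      z ∈ A := by
    rintro z ⟨r, hr, h⟩
    rcases le_total r R with h1 | h1
    · exact ⟨r, hr, h1, h⟩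
    · refine ⟨R, hR, le_rfl, lt_of_le_of_lt ?_ (h.trans_le (lintegral_mono_set fun y _ =>
        hdist y z))⟩
      gcongr
  have hA' : ∀ z, ∃ r : ℝ, z ∈ A → 0 < r ∧ r ≤ R ∧
      s * ENNReal.ofReal r ^ N < ∫⁻ y in closedBall z r, g y ∂μ := fun z => by
    by_cases h : z ∈ A
    · obtain ⟨r, h1, h2⟩ := h
      exact ⟨r, fun _ => ⟨h1, h2⟩⟩
    · exact ⟨0, fun h' => (h h').elim⟩
  choose r hr using hA'
  obtain ⟨u, huA, hdisj, hcov⟩ := Vitali.exists_disjoint_subfamily_covering_enlargement_closedBall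
    A id r R (fun z hz => (hr z hz).2.1) 4 (by norm_num)
  have hu : u.Countable := hdisj.countable_of_nonempty_interior fun z hz =>
    ⟨z, ball_subset_interior_closedBall (mem_ball_self (hr z (huA hz)).1)⟩
  have hsub : {x | ∃ r > 0, s * ENNReal.ofReal r ^ N < ∫⁻ y in closedBall (T x) r, g y ∂μ} ⊆
      ⋃ z ∈ u, closedBall (T z) (4 * r z) := by
    intro x hx
    have hx' := hmem _ hx
    obtain ⟨z, hz, h⟩ := hcov _ hx'
    refine Set.mem_biUnion hz ?_
    have h1 : dist (T x) z ≤ 4 * r z := h (mem_closedBall_self (hr _ hx').1.le)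
    rwa [mem_closedBall, ← hT.dist_eq, hTT]
  calc s * μ {x | ∃ r > 0, s * ENNReal.ofReal r ^ N < ∫⁻ y in closedBall (T x) r, g y ∂μ}
      ≤ s * ∑' z : u, μ (closedBall (T z) (4 * r z)) :=
        mul_le_mul_right ((measure_mono hsub).trans (measure_biUnion_le μ hu _)) _
    _ = ∑' z : u, s * μ (closedBall (T z) (4 * r z)) := ENNReal.tsum_mul_left.symm
    _ ≤ ∑' z : u, V * 4 ^ N * ∫⁻ y in closedBall (z : X) (r z), g y ∂μ := by
        refine ENNReal.tsum_le_tsum fun z => ?_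
        obtain ⟨h1, -, h2⟩ := hr z (huA z.2)
        calc s * μ (closedBall (T z) (4 * r z))
            ≤ s * (V * ENNReal.ofReal (4 * r z) ^ N) := by
              gcongr
              exact hV _ _ (by positivity)
          _ = V * 4 ^ N * (s * ENNReal.ofReal (r z) ^ N) := by
              rw [ENNReal.ofReal_mul (by norm_num), mul_pow, ENNReal.ofReal_ofNat]
              ring
          _ ≤ _ := by gcongr
    _ = V * 4 ^ N * ∫⁻ y in ⋃ z ∈ u, closedBall z (r z), g y ∂μ := by
        rw [ENNReal.tsum_mul_left,
          lintegral_biUnion (s := fun z => closedBall z (r z)) hu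
            (fun z _ => isClosed_closedBall.measurableSet)
          hdisj]
    _ ≤ _ := by
        exact mul_le_mul_right (setLIntegral_le_lintegral _ _) _

theorem lintegral_mul_tsum_indicator_closedBall_le {X : Type*} [PseudoMetricSpace X]
    [MeasurableSpace X] [OpensMeasurableSpace X] {μ : Measure X} {g : X → ℝ≥0∞}
    (hg : AEMeasurable g μ) {s : ℝ≥0∞} {N : ℕ} {z : X}
    (h : ∀ r > 0, ∫⁻ y in closedBall z r, g y ∂μ ≤ s * ENNReal.ofReal r ^ N)
    (w r : ℕ → ℝ) (hr : ∀ i, 0 < r i) :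
    ∫⁻ y, g y * ∑' i, (closedBall z (r i)).indicator
        (fun _ => ENNReal.ofReal (w i / r i ^ N)) y ∂μ ≤ s * ∑' i, ENNReal.ofReal (w i) := by
  have hm : ∀ i, MeasurableSet (closedBall z (r i)) := fun i => isClosed_closedBall.measurableSet
  simp only [← ENNReal.tsum_mul_left]
  have hw : ∀ i, AEMeasurable (fun y => g y * (closedBall z (r i)).indicator
      (fun _ => ENNReal.ofReal (w i / r i ^ N)) y) μ := fun i =>
    hg.mul (measurable_const.indicator (hm i)).aemeasurable
  rw [lintegral_tsum hw]
  refine ENNReal.tsum_le_tsum fun i => ?_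
  have h1 : ∀ y, g y * (closedBall z (r i)).indicator
      (fun _ => ENNReal.ofReal (w i / r i ^ N)) y =
      (closedBall z (r i)).indicator (fun y => g y * ENNReal.ofReal (w i / r i ^ N)) y := fun y => by
    by_cases hy : y ∈ closedBall z (r i) <;> simp [hy]
  simp only [h1]
  rw [lintegral_indicator (hm i), lintegral_mul_const' _ _ ENNReal.ofReal_ne_top]
  have hp : ENNReal.ofReal (r i) ^ N ≠ 0 := pow_ne_zero _ (ENNReal.ofReal_pos.2 (hr i)).ne'
  calc (∫⁻ y in closedBall z (r i), g y ∂μ) * ENNReal.ofReal (w i / r i ^ N)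
      ≤ s * ENNReal.ofReal (r i) ^ N * ENNReal.ofReal (w i / r i ^ N) :=
        mul_le_mul_left (h _ (hr i)) _
    _ = s * ENNReal.ofReal (w i) := by
        rw [ENNReal.ofReal_div_of_pos (pow_pos (hr i) N), ENNReal.ofReal_pow (hr i).le, mul_assoc,
          ENNReal.mul_div_cancel hp (by finiteness)]

/-! ### Geometry of the sphere -/

theorem sphMeasure_closedBall_le (N : ℕ) : ∃ V : ℝ≥0, ∀ (x : Sph N) (r : ℝ), 0 < r →
    sphMeasure N (closedBall x r) ≤ V * ENNReal.ofReal r ^ N := by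
  set W : ℝ≥0∞ := volume (closedBall (0 : EuclideanSpace ℝ (Fin (N + 1))) 1) with hW
  have hWtop : W ≠ ∞ := measure_closedBall_lt_top.ne
  refine ⟨(2 ^ (N + 1) * W).toNNReal, fun x r hr => ?_⟩
  rw [ENNReal.coe_toNNReal (by finiteness)]
  set S : Set (Set.Ioi (0 : ℝ)) := Subtype.val ⁻¹' Set.Ioo 1 (1 + r) with hS
  have hSm : MeasurableSet S := measurable_subtype_coe measurableSet_Ioo
  have h1 : ENNReal.ofReal r ≤ Measure.volumeIoiPow N S := by
    rw [Measure.volumeIoiPow, withDensity_apply _ hSm]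
    calc ENNReal.ofReal r = ∫⁻ _ in S, 1 ∂(Measure.comap Subtype.val volume) := by
          rw [setLIntegral_one, comap_subtype_coe_apply measurableSet_Ioi, hS,
            Subtype.image_preimage_coe, Set.inter_eq_right.2, Real.volume_Ioo]
          · congr 1; ring
          · exact fun t ht => one_pos.trans ht.1
      _ ≤ _ := by
          refine setLIntegral_mono' hSm fun t ht => ?_
          rw [ENNReal.one_le_ofReal]
          exact one_le_pow₀ ht.1.le
  have h2 := (Measure.measurePreserving_homeomorphUnitSphereProd
    (volume : Measure (EuclideanSpace ℝ (Fin (N + 1))))).measure_preimage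
    ((isClosed_closedBall (x := x) (ε := r)).measurableSet.prod hSm).nullMeasurableSet
  rw [Measure.prod_prod, comap_subtype_coe_apply (measurableSet_singleton _).compl,
    finrank_euclideanSpace, Fintype.card_fin, Nat.add_sub_cancel] at h2
  have h3 : Subtype.val '' (homeomorphUnitSphereProd (EuclideanSpace ℝ (Fin (N + 1))) ⁻¹'
      (closedBall x r ×ˢ S)) ⊆ closedBall (x : EuclideanSpace ℝ (Fin (N + 1))) (2 * r) := by
    rintro _ ⟨p, hp, rfl⟩
    set q := homeomorphUnitSphereProd (EuclideanSpace ℝ (Fin (N + 1))) p with hq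
    have hp' : (p : EuclideanSpace ℝ (Fin (N + 1))) = (q.2 : ℝ) • (q.1 : _) := by
      have hx : ‖(p : EuclideanSpace ℝ (Fin (N + 1)))‖ ≠ 0 := norm_ne_zero_iff.2 p.2
      simp [hq, hx]
    have hb : dist (q.1 : EuclideanSpace ℝ (Fin (N + 1))) x ≤ r := hp.1
    have ht : (q.2 : ℝ) ∈ Set.Ioo 1 (1 + r) := hp.2
    have h4 : dist ((q.2 : ℝ) • (q.1 : EuclideanSpace ℝ (Fin (N + 1)))) q.1 ≤ r := by
      have h5 : (q.2 : ℝ) • (q.1 : EuclideanSpace ℝ (Fin (N + 1))) - q.1 =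
          ((q.2 : ℝ) - 1) • (q.1 : _) := by rw [sub_smul, one_smul]
      rw [dist_eq_norm, h5, norm_smul, norm_eq_of_mem_sphere, mul_one, Real.norm_eq_abs,
        abs_of_pos (by linarith [ht.1])]
      linarith [ht.2]
    rw [mem_closedBall, hp']
    linarith [dist_triangle ((q.2 : ℝ) • (q.1 : EuclideanSpace ℝ (Fin (N + 1)))) q.1 x]
  have h4 : sphMeasure N (closedBall x r) * ENNReal.ofReal r ≤
      2 ^ (N + 1) * W * ENNReal.ofReal r ^ N * ENNReal.ofReal r := by
    calc sphMeasure N (closedBall x r) * ENNReal.ofReal r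
        ≤ sphMeasure N (closedBall x r) * Measure.volumeIoiPow N S := by gcongr
      _ ≤ volume (closedBall (x : EuclideanSpace ℝ (Fin (N + 1))) (2 * r)) := by
          rw [sphMeasure, ← h2]
          exact measure_mono h3
      _ = _ := by
          rw [Measure.addHaar_closedBall' _ _ (by positivity), finrank_euclideanSpace,
            Fintype.card_fin, mul_pow, ENNReal.ofReal_mul (by positivity),
            ENNReal.ofReal_pow (by positivity), ENNReal.ofReal_pow hr.le, ENNReal.ofReal_ofNat]
          ring
  exact (ENNReal.mul_le_mul_iff_left (ENNReal.ofReal_pos.2 hr).ne' ENNReal.ofReal_ne_top).1 h4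

theorem Sph.dist_eq_sqrt {N : ℕ} (x y : Sph N) : dist x y = √(2 - 2 *
    ⟪(x : EuclideanSpace ℝ (Fin (N + 1))), (y : EuclideanSpace ℝ (Fin (N + 1)))⟫) := by
  rw [Subtype.dist_eq, dist_eq_norm, ← Real.sqrt_sq (norm_nonneg _), norm_sub_sq_real,
    norm_eq_of_mem_sphere, norm_eq_of_mem_sphere]
  congr 1
  ring

theorem Sph.inner_antipode {N : ℕ} (x y : Sph N) :
    ⟪(antipode x : EuclideanSpace ℝ (Fin (N + 1))), (y : EuclideanSpace ℝ (Fin (N + 1)))⟫ =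
      -⟪(x : EuclideanSpace ℝ (Fin (N + 1))), (y : EuclideanSpace ℝ (Fin (N + 1)))⟫ :=
  inner_neg_left _ _

theorem antipode_involutive (N : ℕ) : Function.Involutive (antipode (N := N)) := fun _ =>
  Subtype.ext (neg_neg _)

theorem isometry_antipode (N : ℕ) : Isometry (antipode (N := N)) :=
  Isometry.of_dist_eq fun x y => by
    rw [Subtype.dist_eq, Subtype.dist_eq]
    exact dist_neg_neg _ _

/-! ### The maximal Cesàro operator -/

theorem IsFourierLaplaceBasis.exists_cesaroMaximal_le {N : ℕ} {a : ℕ → ℕ}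
    {Y : (k : ℕ) → Fin (a k) → Sph N → ℝ} (hY : IsFourierLaplaceBasis N a Y) {lam α : ℝ}
    (hl : 0 < lam) (hN : (N : ℝ) = 2 * lam + 1) (hα : lam < α) :
    ∃ K : ℝ≥0, ∀ f : Sph N → ℝ, Integrable f (sphMeasure N) → ∀ (s : ℝ≥0∞) (x : Sph N),
      (∀ r > 0, ∫⁻ y in closedBall x r, ‖f y‖ₑ ∂(sphMeasure N) ≤ s * ENNReal.ofReal r ^ N) →
      (∀ r > 0, ∫⁻ y in closedBall (antipode x) r, ‖f y‖ₑ ∂(sphMeasure N) ≤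
        s * ENNReal.ofReal r ^ N) →
      cesaroMaximal Y α f x ≤ K * s := by
  obtain ⟨v, hv, hK⟩ := exists_cesaroKernel_eq hY hl hN
  obtain ⟨C, q₁, q₂, hC, ⟨hq₁, hq₁'⟩, ⟨hq₂, hq₂'⟩, hb⟩ := exists_zonalKernel_dyadic_bound hl hα hN
  have hfin : ∀ q : ℝ, 0 < q → q < 1 → ∑' i : ℕ, ENNReal.ofReal (v * C * q ^ i) ≠ ∞ :=
    fun q h h' => ((summable_geometric_of_lt_one h.le h').mul_left _).tsum_ofReal_ne_top
  refine ⟨(∑' i : ℕ, ENNReal.ofReal (v * C * q₁ ^ i) +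
    ∑' i : ℕ, ENNReal.ofReal (v * C * q₂ ^ i)).toNNReal, fun f hf s x h1 h2 => ?_⟩
  rw [ENNReal.coe_toNNReal (ENNReal.add_ne_top.2 ⟨hfin _ hq₁ hq₁', hfin _ hq₂ hq₂'⟩)]
  refine iSup₂_le fun n hn => ?_
  set r₁ : ℕ → ℝ := fun i => 2 ^ (i + 1) * (1 / ((n : ℝ) + 1)) with hr₁
  set r₂ : ℕ → ℝ := fun i => 2 * (1 / 2) ^ i with hr₂
  have hr₁0 : ∀ i, 0 < r₁ i := fun i => by positivity
  have hr₂0 : ∀ i, 0 < r₂ i := fun i => by positivity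
  set M₁ : Sph N → ℝ≥0∞ := fun y => ∑' i, (closedBall x (r₁ i)).indicator
    (fun _ => ENNReal.ofReal (v * C * q₁ ^ i / r₁ i ^ N)) y with hM₁
  set M₂ : Sph N → ℝ≥0∞ := fun y => ∑' i, (closedBall (antipode x) (r₂ i)).indicator
    (fun _ => ENNReal.ofReal (v * C * q₂ ^ i / r₂ i ^ N)) y with hM₂
  have key : ∀ (z : Sph N) (r : ℕ → ℝ) (_ : ∀ i, 0 < r i) (q ζ : ℝ) (y : Sph N) (i : ℕ),
      dist z y ≤ r i → |ζ| * r i ^ N ≤ C * q ^ i → ENNReal.ofReal |v * ζ| ≤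
        ∑' i, (closedBall z (r i)).indicator
          (fun _ => ENNReal.ofReal (v * C * q ^ i / r i ^ N)) y := by
    intro z r hr q ζ y i hd hi
    refine le_trans ?_ (ENNReal.le_tsum i)
    rw [Set.indicator_of_mem (by rwa [mem_closedBall, dist_comm])]
    refine ENNReal.ofReal_le_ofReal ?_
    rw [abs_mul, abs_of_pos hv, mul_assoc, mul_div_assoc]
    refine mul_le_mul_of_nonneg_left ?_ hv.le
    rwa [le_div_iff₀ (pow_pos (hr i) N)]
  have hker : ∀ y, ENNReal.ofReal |cesaroKernel Y α n x y| ≤ M₁ y + M₂ y := by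
    intro y
    set t := ⟪(x : EuclideanSpace ℝ (Fin (N + 1))), (y : EuclideanSpace ℝ (Fin (N + 1)))⟫ with ht
    have ht1 : |t| ≤ 1 := by
      simpa using abs_real_inner_le_norm (x : EuclideanSpace ℝ (Fin (N + 1))) y
    rw [hK]
    rcases hb n hn t (abs_le.1 ht1).1 (abs_le.1 ht1).2 with ⟨i, hi, hi'⟩ | ⟨i, hi, hi'⟩
    · rw [← Sph.dist_eq_sqrt] at hi
      exact le_add_right (key x r₁ hr₁0 q₁ _ y i hi hi')
    · rw [← sub_neg_eq_add, ← mul_neg, ht, ← Sph.inner_antipode, ← Sph.dist_eq_sqrt] at hi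
      exact le_add_left (key (antipode x) r₂ hr₂0 q₂ _ y i hi hi')
  have hf' : AEMeasurable (fun y => ‖f y‖ₑ) (sphMeasure N) := hf.1.enorm
  have hM₁m : Measurable M₁ := Measurable.tsum fun i =>
    measurable_const.indicator isClosed_closedBall.measurableSet
  rw [hY.cesaroMean_eq α hf, ← Real.enorm_eq_ofReal_abs]
  calc ‖∫ y, f y * cesaroKernel Y α n x y ∂(sphMeasure N)‖ₑ
      ≤ ∫⁻ y, ‖f y * cesaroKernel Y α n x y‖ₑ ∂(sphMeasure N) :=
        enorm_integral_le_lintegral_enorm _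
    _ ≤ ∫⁻ y, (‖f y‖ₑ * M₁ y + ‖f y‖ₑ * M₂ y) ∂(sphMeasure N) := by
        refine lintegral_mono fun y => ?_
        rw [enorm_mul, ← mul_add, Real.enorm_eq_ofReal_abs (cesaroKernel Y α n x y)]
        exact mul_le_mul_right (hker y) _
    _ = ∫⁻ y, ‖f y‖ₑ * M₁ y ∂(sphMeasure N) + ∫⁻ y, ‖f y‖ₑ * M₂ y ∂(sphMeasure N) :=
        lintegral_add_left' (hf'.mul hM₁m.aemeasurable) _
    _ ≤ s * ∑' i : ℕ, ENNReal.ofReal (v * C * q₁ ^ i) +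
        s * ∑' i : ℕ, ENNReal.ofReal (v * C * q₂ ^ i) :=
        add_le_add
          (lintegral_mul_tsum_indicator_closedBall_le hf' h1 (fun i => v * C * q₁ ^ i) r₁ hr₁0)
          (lintegral_mul_tsum_indicator_closedBall_le hf' h2 (fun i => v * C * q₂ ^ i) r₂ hr₂0)
    _ = _ := by rw [← mul_add, mul_comm]

/-- For `N ≥ 2` and `α > (N−1)/2` the Cesàro maximal operator `S_*^α`
is of weak type `(1,1)` on the sphere: `σ{S_*^α f > μ} ≤ c ‖f‖₁ / μ`. -/
theorem cesaro_maximal_weak_type_one_one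
    (N : ℕ) (hN : 2 ≤ N) (a : ℕ → ℕ) (Y : (k : ℕ) → Fin (a k) → Sph N → ℝ)
    (hY : IsFourierLaplaceBasis N a Y) (α : ℝ) (hα : ((N : ℝ) - 1) / 2 < α) :
    ∃ c : ℝ≥0, ∀ f : Sph N → ℝ, Integrable f (sphMeasure N) → ∀ μ : ℝ, 0 < μ →
      sphMeasure N {x : Sph N | ENNReal.ofReal μ < cesaroMaximal Y α f x} ≤
        c * eLpNorm f 1 (sphMeasure N) / ENNReal.ofReal μ := by
  have hN' : (2 : ℝ) ≤ N := by exact_mod_cast hN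
  obtain ⟨K, hK⟩ := hY.exists_cesaroMaximal_le (lam := ((N : ℝ) - 1) / 2) (by linarith) (by ring) hα
  obtain ⟨V, hV⟩ := sphMeasure_closedBall_le N
  refine ⟨(K + 1) * (2 * (V * 4 ^ N)), fun f hf μ hμ => ?_⟩
  have hdist : ∀ x y : Sph N, dist x y ≤ 2 := fun x y => by
    have h := dist_le_norm_add_norm (x : EuclideanSpace ℝ (Fin (N + 1))) y
    rw [norm_eq_of_mem_sphere, norm_eq_of_mem_sphere] at h
    rw [Subtype.dist_eq]
    linarith
  set s : ℝ≥0∞ := ENNReal.ofReal μ / (K + 1) with hs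
  have hKs : (K + 1) * s = ENNReal.ofReal μ := ENNReal.mul_div_cancel (by simp) (by finiteness)
  set B : (Sph N → Sph N) → Set (Sph N) := fun T => {x | ∃ r > 0, s * ENNReal.ofReal r ^ N <
    ∫⁻ y in closedBall (T x) r, ‖f y‖ₑ ∂(sphMeasure N)} with hB
  have hsub : {x : Sph N | ENNReal.ofReal μ < cesaroMaximal Y α f x} ⊆ B id ∪ B antipode := by
    intro x hx
    by_contra h
    simp only [hB, Set.mem_union, Set.mem_ofPred_eq, not_or, not_exists, not_and, not_lt] at h
    have h1 := hK f hf s x h.1 h.2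
    have h2 : (K : ℝ≥0∞) * s ≤ ENNReal.ofReal μ := by
      rw [← hKs]
      gcongr
      exact le_self_add
    exact (lt_irrefl _ (hx.trans_le (h1.trans h2))).elim
  have h1 := mul_measure_le_of_lt_setLIntegral_closedBall hV two_pos hdist isometry_id
    (fun _ => rfl) (fun y => ‖f y‖ₑ) s
  have h2 := mul_measure_le_of_lt_setLIntegral_closedBall hV two_pos hdist (isometry_antipode N)
    (antipode_involutive N) (fun y => ‖f y‖ₑ) s
  have h3 : s * sphMeasure N {x : Sph N | ENNReal.ofReal μ < cesaroMaximal Y α f x} ≤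
      2 * (V * 4 ^ N) * eLpNorm f 1 (sphMeasure N) := by
    calc s * sphMeasure N {x : Sph N | ENNReal.ofReal μ < cesaroMaximal Y α f x}
        ≤ s * (sphMeasure N (B id) + sphMeasure N (B antipode)) :=
          mul_le_mul_right ((measure_mono hsub).trans (measure_union_le _ _)) _
      _ ≤ _ := by
          rw [mul_add, eLpNorm_one_eq_lintegral_enorm, mul_assoc, two_mul]
          exact add_le_add h1 h2
  rw [ENNReal.le_div_iff_mul_le (Or.inl (ENNReal.ofReal_pos.2 hμ).ne')
    (Or.inl ENNReal.ofReal_ne_top), mul_comm]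
  have h4 := mul_le_mul_right h3 ((K : ℝ≥0∞) + 1)
  rw [← mul_assoc, hKs, ← mul_assoc] at h4
  exact_mod_cast h4
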